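/- arXiv:2406.09942 — 7 statements merged into one kernel-verified Lean document; each statement's English description precedes it below -/
import Mathlib

section
/- Fix a pole configuration and let Θ₀ be the associated multi-angle potential. Fix j ∈ {1,…,k} and a point x̄ ∈ Γ₀^j∖{0}. Then the one-sided limits of e^{iΘ₀} at x̄ from the two sides {x : x·ν^j > 0} and {x : x·ν^j < 0} exist and satisfy (e^{iΘ₀})⁻(x̄) = e^{−2πiρʲ}·(e^{iΘ₀})⁺(x̄). Consequently, if φ, ψ are real-valued functions defined on a punctured neighbourhood of x̄ minus Γ₀^j and admitting one-sided limits φ⁺, ψ⁺ (from the side x·ν^j > 0) and φ⁻, ψ⁻ (from the side x·ν^j < 0) at x̄, then the complex function u := e^{iΘ₀}·(φ + iψ) has equal one-sided limits at x̄ from the two sides if and only if φ⁻ + iψ⁻ = e^{2πiρʲ}·(φ⁺ + iψ⁺), i.e. if and only if φ⁻ = b_j φ⁺ − d_j ψ⁺ and ψ⁻ = d_j φ⁺ + b_j ψ⁺. -/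
noncomputable section

open Real Set Filter Topology

/-- A configuration of poles: an integer `k ≥ 1`, circulations `ρ¹,…,ρᵏ`, and angles
`α¹,…,αᵏ ∈ (−π,π]` that are pairwise distinct modulo `π`. -/
structure PoleConfig (k : ℕ) : Type where
  rho : Fin k → ℝ
  alpha : Fin k → ℝ
  k_pos : 1 ≤ k
  alpha_mem : ∀ j, alpha j ∈ Set.Ioc (-Real.pi) Real.pi
  alpha_distinct : ∀ i j : Fin k, i ≠ j →
    alpha i ≠ alpha j ∧ alpha i ≠ alpha j + Real.pi ∧ alpha i ≠ alpha j - Real.pi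

/-- The step function `χ_{[a+π, 2π)}`. -/
def chiStep (a t : ℝ) : ℝ := if a + Real.pi ≤ t then 1 else 0

/-- `f(t) = ∑ⱼ ρʲ · χ_{[αʲ+π, 2π)}(t)`. -/
def fStep {k : ℕ} (P : PoleConfig k) (t : ℝ) : ℝ := ∑ j, P.rho j * chiStep (P.alpha j) t

/-- Euclidean dot product on `ℝ²`. -/
def dot2 (x y : ℝ × ℝ) : ℝ := x.1 * y.1 + x.2 * y.2

/-- The unit normal `ν^j = (−sin αʲ, cos αʲ)` to the `j`-th half-line. -/
def nu2 {k : ℕ} (P : PoleConfig k) (j : Fin k) : ℝ × ℝ :=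
  (-Real.sin (P.alpha j), Real.cos (P.alpha j))

/-- The filter of approach to `y` from the side `{x·ν^j > 0}`. -/
def plusSide {k : ℕ} (P : PoleConfig k) (j : Fin k) (y : ℝ × ℝ) : Filter (ℝ × ℝ) :=
  nhdsWithin y {x : ℝ × ℝ | 0 < dot2 x (nu2 P j)}

/-- The filter of approach to `y` from the side `{x·ν^j < 0}`. -/
def minusSide {k : ℕ} (P : PoleConfig k) (j : Fin k) (y : ℝ × ℝ) : Filter (ℝ × ℝ) :=
  nhdsWithin y {x : ℝ × ℝ | dot2 x (nu2 P j) < 0}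

/-- `conj x * e^{ia}` as a complex number. -/
def wRot (a : ℝ) (x : ℝ × ℝ) : ℂ :=
  ⟨x.1 * Real.cos a + x.2 * Real.sin a, x.1 * Real.sin a - x.2 * Real.cos a⟩

lemma wRot_continuous (a : ℝ) : Continuous (wRot a) := by
  have h : wRot a = fun x : ℝ × ℝ => Complex.equivRealProdCLM.symm
      (x.1 * Real.cos a + x.2 * Real.sin a, x.1 * Real.sin a - x.2 * Real.cos a) := by
    funext x
    apply Complex.ext <;> simp [wRot]
  rw [h]
  fun_prop

lemma wRot_polar (a r t : ℝ) : wRot a (r * Real.cos t, r * Real.sin t) =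
    (r : ℂ) * (Complex.cos ((a - t : ℝ) : ℂ) + Complex.sin ((a - t : ℝ) : ℂ) * Complex.I) := by
  rw [← Complex.ofReal_cos, ← Complex.ofReal_sin]
  apply Complex.ext
  · simp only [wRot, Complex.mul_re, Complex.add_re, Complex.add_im, Complex.mul_im,
      Complex.ofReal_re, Complex.ofReal_im, Complex.I_re, Complex.I_im, Real.cos_sub]
    ring
  · simp only [wRot, Complex.mul_re, Complex.add_re, Complex.add_im, Complex.mul_im,
      Complex.ofReal_re, Complex.ofReal_im, Complex.I_re, Complex.I_im, Real.sin_sub]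
    ring

lemma theta_eq (a r t : ℝ) (ha : a ∈ Set.Ioc (-Real.pi) Real.pi) (hr : 0 < r)
    (ht : t ∈ Set.Ico (0 : ℝ) (2 * Real.pi)) :
    -a + t + Real.pi * (1 - 2 * chiStep a t) =
      Real.pi - Complex.arg (wRot a (r * Real.cos t, r * Real.sin t)) := by
  obtain ⟨ha1, ha2⟩ := ha
  obtain ⟨ht1, ht2⟩ := ht
  rw [wRot_polar]
  unfold chiStep
  split_ifs with h
  · have e : (Complex.cos ((a - t : ℝ) : ℂ) + Complex.sin ((a - t : ℝ) : ℂ) * Complex.I) =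
        (Complex.cos ((a - t + 2 * Real.pi : ℝ) : ℂ)
          + Complex.sin ((a - t + 2 * Real.pi : ℝ) : ℂ) * Complex.I) := by
      rw [← Complex.ofReal_cos, ← Complex.ofReal_sin, ← Complex.ofReal_cos, ← Complex.ofReal_sin,
        Real.cos_add_two_pi, Real.sin_add_two_pi]
    rw [e, Complex.arg_mul_cos_add_sin_mul_I hr ⟨by linarith, by linarith⟩]
    ring
  · rw [Complex.arg_mul_cos_add_sin_mul_I hr ⟨by linarith, by linarith⟩]
    ring

lemma exists_polar (x : ℝ × ℝ) (hx : x ≠ 0) : ∃ r : ℝ, 0 < r ∧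
    ∃ t ∈ Set.Ico (0 : ℝ) (2 * Real.pi), x = (r * Real.cos t, r * Real.sin t) := by
  set z : ℂ := ⟨x.1, x.2⟩ with hz
  have hz0 : z ≠ 0 := by
    intro h
    apply hx
    have h1 := congrArg Complex.re h
    have h2 := congrArg Complex.im h
    exact Prod.ext h1 h2
  have hre := Complex.norm_mul_cos_arg z
  have him := Complex.norm_mul_sin_arg z
  have l1 := Complex.neg_pi_lt_arg z
  have l2 := Complex.arg_le_pi z
  have hp := Real.pi_pos
  refine ⟨‖z‖, norm_pos_iff.mpr hz0, ?_⟩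
  by_cases h : 0 ≤ Complex.arg z
  · exact ⟨Complex.arg z, ⟨h, by linarith⟩, Prod.ext hre.symm him.symm⟩
  · refine ⟨Complex.arg z + 2 * Real.pi, ⟨by linarith, by linarith⟩, ?_⟩
    rw [Real.cos_add_two_pi, Real.sin_add_two_pi]
    exact Prod.ext hre.symm him.symm

lemma side_neBot {k : ℕ} (P : PoleConfig k) (j : Fin k) (y : ℝ × ℝ)
    (hy : dot2 y (nu2 P j) = 0) : (plusSide P j y).NeBot ∧ (minusSide P j y).NeBot := by
  have hd : ∀ e : ℝ, dot2 (y.1 + e * (nu2 P j).1, y.2 + e * (nu2 P j).2) (nu2 P j) = e := by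
    intro e
    have h2 := Real.sin_sq_add_cos_sq (P.alpha j)
    simp only [dot2, nu2] at hy ⊢
    linear_combination hy + e * h2
  have hc : Tendsto (fun e : ℝ => (y.1 + e * (nu2 P j).1, y.2 + e * (nu2 P j).2))
      (𝓝 0) (𝓝 y) := by
    have : Continuous (fun e : ℝ => (y.1 + e * (nu2 P j).1, y.2 + e * (nu2 P j).2)) := by
      fun_prop
    simpa using this.tendsto 0
  constructor
  · have : Tendsto (fun e : ℝ => (y.1 + e * (nu2 P j).1, y.2 + e * (nu2 P j).2))
      (𝓝[>] 0) (plusSide P j y) := by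
      refine tendsto_nhdsWithin_iff.mpr ⟨hc.mono_left nhdsWithin_le_nhds, ?_⟩
      filter_upwards [self_mem_nhdsWithin] with e he
      simpa only [Set.mem_ofPred_eq, hd, Set.mem_Ioi, Set.mem_Iio] using he
    exact this.neBot
  · have : Tendsto (fun e : ℝ => (y.1 + e * (nu2 P j).1, y.2 + e * (nu2 P j).2))
      (𝓝[<] 0) (minusSide P j y) := by
      refine tendsto_nhdsWithin_iff.mpr ⟨hc.mono_left nhdsWithin_le_nhds, ?_⟩
      filter_upwards [self_mem_nhdsWithin] with e he
      simpa only [Set.mem_ofPred_eq, hd, Set.mem_Ioi, Set.mem_Iio] using he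
    exact this.neBot

lemma wRot_base (a b s : ℝ) : wRot a (s * Real.cos (b + Real.pi), s * Real.sin (b + Real.pi)) =
    ⟨-(s * Real.cos (a - b)), -(s * Real.sin (a - b))⟩ := by
  apply Complex.ext
  · simp only [wRot, Real.cos_add_pi, Real.sin_add_pi, Real.cos_sub]
    ring
  · simp only [wRot, Real.cos_add_pi, Real.sin_add_pi, Real.sin_sub]
    ring

lemma wRot_slit (a b s : ℝ) (hs : 0 < s) (ha : a ∈ Set.Ioc (-Real.pi) Real.pi)
    (hb : b ∈ Set.Ioc (-Real.pi) Real.pi) (hab : a ≠ b) :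
    wRot a (s * Real.cos (b + Real.pi), s * Real.sin (b + Real.pi)) ∈ Complex.slitPlane := by
  rw [wRot_base, Complex.mem_slitPlane_iff]
  by_contra h
  push Not at h
  obtain ⟨h1, h2⟩ := h
  simp only [neg_eq_zero, mul_eq_zero, hs.ne', false_or] at h2
  simp only [Left.neg_nonpos_iff] at h1
  have h3 : 0 ≤ Real.cos (a - b) := by
    by_contra h4
    push Not at h4
    nlinarith
  have h5 : Real.cos (a - b) = 1 := by
    have := Real.sin_sq_add_cos_sq (a - b)
    rw [h2] at this
    nlinarith
  have h6 := (Real.cos_eq_one_iff_of_lt_of_lt (x := a - b) (by linarith [ha.1, hb.2])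
    (by linarith [ha.2, hb.1])).mp h5
  exact hab (by linarith)

lemma Theta_limits
    (k : ℕ) (P : PoleConfig k) (Θ₀ : ℝ × ℝ → ℝ)
    (hΘ : ∀ r : ℝ, 0 < r → ∀ t ∈ Set.Ico (0 : ℝ) (2 * Real.pi),
      Θ₀ (r * Real.cos t, r * Real.sin t) =
        ∑ j, P.rho j * (-(P.alpha j) + t + Real.pi * (1 - 2 * chiStep (P.alpha j) t)))
    (j : Fin k) (s : ℝ) (hs : 0 < s) (x₀ : ℝ × ℝ)
    (hx₀ : x₀ = (s * Real.cos (P.alpha j + Real.pi), s * Real.sin (P.alpha j + Real.pi))) :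
    ∃ T : ℝ, Tendsto Θ₀ (plusSide P j x₀) (𝓝 T) ∧
      Tendsto Θ₀ (minusSide P j x₀) (𝓝 (T - 2 * Real.pi * P.rho j)) := by
  have hform : ∀ x : ℝ × ℝ, x ≠ 0 →
      Θ₀ x = ∑ i, P.rho i * (Real.pi - Complex.arg (wRot (P.alpha i) x)) := by
    intro x hx
    obtain ⟨r, hr, t, ht, rfl⟩ := exists_polar x hx
    rw [hΘ r hr t ht]
    refine Finset.sum_congr rfl fun i _ => ?_
    rw [theta_eq _ r t (P.alpha_mem i) hr ht]
  have hx0 : ∀ x : ℝ × ℝ, dot2 x (nu2 P j) ≠ 0 → x ≠ 0 := by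
    rintro x h rfl
    exact h (by simp [dot2])
  have him : ∀ x : ℝ × ℝ, (wRot (P.alpha j) x).im = - dot2 x (nu2 P j) := by
    intro x
    simp only [wRot, dot2, nu2]
    ring
  have hre0 : (wRot (P.alpha j) x₀).re < 0 := by
    rw [hx₀, wRot_base]
    simpa using hs
  have him0 : (wRot (P.alpha j) x₀).im = 0 := by
    rw [hx₀, wRot_base]
    simp
  have harg0 : Complex.arg (wRot (P.alpha j) x₀) = Real.pi :=
    Complex.arg_eq_pi_iff.mpr ⟨hre0, him0⟩
  have hcont : ∀ i, i ≠ j → ContinuousAt (fun x => Complex.arg (wRot (P.alpha i) x)) x₀ := by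
    intro i hij
    refine ContinuousAt.comp (g := Complex.arg) (Complex.continuousAt_arg ?_)
      (wRot_continuous _).continuousAt
    rw [hx₀]
    exact wRot_slit _ _ s hs (P.alpha_mem i) (P.alpha_mem j) (P.alpha_distinct i j hij).1
  have hjp : Tendsto (fun x => Complex.arg (wRot (P.alpha j) x)) (plusSide P j x₀)
      (𝓝 (-Real.pi)) := by
    refine (Complex.tendsto_arg_nhdsWithin_im_neg_of_re_neg_of_im_zero hre0 him0).comp ?_
    refine tendsto_nhdsWithin_iff.mpr
      ⟨((wRot_continuous _).tendsto x₀).mono_left nhdsWithin_le_nhds, ?_⟩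
    filter_upwards [self_mem_nhdsWithin] with x hx
    have hx' : 0 < dot2 x (nu2 P j) := hx
    show (wRot (P.alpha j) x).im < 0
    rw [him]
    linarith
  have hjm : Tendsto (fun x => Complex.arg (wRot (P.alpha j) x)) (minusSide P j x₀)
      (𝓝 Real.pi) := by
    refine (Complex.tendsto_arg_nhdsWithin_im_nonneg_of_re_neg_of_im_zero hre0 him0).comp ?_
    refine tendsto_nhdsWithin_iff.mpr
      ⟨((wRot_continuous _).tendsto x₀).mono_left nhdsWithin_le_nhds, ?_⟩
    filter_upwards [self_mem_nhdsWithin] with x hx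
    have hx' : dot2 x (nu2 P j) < 0 := hx
    show 0 ≤ (wRot (P.alpha j) x).im
    rw [him]
    linarith
  refine ⟨∑ i, (P.rho i * (Real.pi - Complex.arg (wRot (P.alpha i) x₀))
      + if i = j then 2 * Real.pi * P.rho j else 0), ?_, ?_⟩
  · have h : Tendsto (fun x => ∑ i, P.rho i * (Real.pi - Complex.arg (wRot (P.alpha i) x)))
        (plusSide P j x₀) (𝓝 (∑ i, (P.rho i * (Real.pi - Complex.arg (wRot (P.alpha i) x₀))
          + if i = j then 2 * Real.pi * P.rho j else 0))) := by
      refine tendsto_finsetSum _ fun i _ => ?_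
      by_cases hij : i = j
      · subst hij
        convert (hjp.const_sub Real.pi).const_mul (P.rho i) using 2
        rw [harg0, if_pos rfl]
        ring
      · rw [if_neg hij, add_zero]
        exact (((hcont i hij).tendsto.mono_left nhdsWithin_le_nhds).const_sub _).const_mul _
    refine h.congr' ?_
    filter_upwards [self_mem_nhdsWithin] with x hx
    exact (hform x (hx0 x (ne_of_gt hx))).symm
  · have h : Tendsto (fun x => ∑ i, P.rho i * (Real.pi - Complex.arg (wRot (P.alpha i) x)))
        (minusSide P j x₀) (𝓝 (∑ i, P.rho i * (Real.pi - Complex.arg (wRot (P.alpha i) x₀)))) := by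
      refine tendsto_finsetSum _ fun i _ => ?_
      by_cases hij : i = j
      · subst hij
        rw [harg0]
        exact (hjm.const_sub Real.pi).const_mul (P.rho i)
      · exact (((hcont i hij).tendsto.mono_left nhdsWithin_le_nhds).const_sub _).const_mul _
    rw [Finset.sum_add_distrib, Finset.sum_ite_eq' Finset.univ j, if_pos (Finset.mem_univ j),
      add_sub_cancel_right]
    refine h.congr' ?_
    filter_upwards [self_mem_nhdsWithin] with x hx
    exact (hform x (hx0 x (ne_of_lt hx))).symm

/- STATEMENT 2: across each half-line Γ₀^j the gauge phase e^{iΘ₀} jumps by the factor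
   e^{−2πiρʲ}, and consequently the gauged function u = e^{iΘ₀}(φ+iψ) has equal one-sided
   limits from the two sides iff (φ,ψ) satisfies the transmission conditions R^j = I^j = 0. -/

theorem gauge_jump_across_crack
    (k : ℕ) (P : PoleConfig k) (Θ₀ : ℝ × ℝ → ℝ)
    (hΘ : ∀ r : ℝ, 0 < r → ∀ t ∈ Set.Ico (0 : ℝ) (2 * Real.pi),
      Θ₀ (r * Real.cos t, r * Real.sin t) =
        ∑ j, P.rho j * (-(P.alpha j) + t + Real.pi * (1 - 2 * chiStep (P.alpha j) t)))
    (j : Fin k) (s : ℝ) (hs : 0 < s) (x₀ : ℝ × ℝ)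
    (hx₀ : x₀ = (s * Real.cos (P.alpha j + Real.pi), s * Real.sin (P.alpha j + Real.pi))) :
    (∃ Lp : ℂ,
      Filter.Tendsto (fun x : ℝ × ℝ => Complex.exp (Complex.I * (Θ₀ x : ℂ)))
        (plusSide P j x₀) (nhds Lp) ∧
      Filter.Tendsto (fun x : ℝ × ℝ => Complex.exp (Complex.I * (Θ₀ x : ℂ)))
        (minusSide P j x₀)
        (nhds (Complex.exp (-((2 * Real.pi * P.rho j : ℝ) : ℂ) * Complex.I) * Lp))) ∧
    (∀ φ ψ : ℝ × ℝ → ℝ, ∀ φp ψp φm ψm : ℝ,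
      Filter.Tendsto φ (plusSide P j x₀) (nhds φp) →
      Filter.Tendsto ψ (plusSide P j x₀) (nhds ψp) →
      Filter.Tendsto φ (minusSide P j x₀) (nhds φm) →
      Filter.Tendsto ψ (minusSide P j x₀) (nhds ψm) →
      ((∃ c : ℂ,
          Filter.Tendsto (fun x : ℝ × ℝ =>
              Complex.exp (Complex.I * (Θ₀ x : ℂ)) * ((φ x : ℂ) + Complex.I * (ψ x : ℂ)))
            (plusSide P j x₀) (nhds c) ∧
          Filter.Tendsto (fun x : ℝ × ℝ =>
              Complex.exp (Complex.I * (Θ₀ x : ℂ)) * ((φ x : ℂ) + Complex.I * (ψ x : ℂ)))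
            (minusSide P j x₀) (nhds c)) ↔
        ((φm : ℂ) + Complex.I * (ψm : ℂ) =
          Complex.exp (((2 * Real.pi * P.rho j : ℝ) : ℂ) * Complex.I) *
            ((φp : ℂ) + Complex.I * (ψp : ℂ)))) ∧
      (((φm : ℂ) + Complex.I * (ψm : ℂ) =
          Complex.exp (((2 * Real.pi * P.rho j : ℝ) : ℂ) * Complex.I) *
            ((φp : ℂ) + Complex.I * (ψp : ℂ))) ↔
        (φm = Real.cos (2 * Real.pi * P.rho j) * φp - Real.sin (2 * Real.pi * P.rho j) * ψp ∧
          ψm = Real.sin (2 * Real.pi * P.rho j) * φp +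
            Real.cos (2 * Real.pi * P.rho j) * ψp))) := by
  obtain ⟨T, hTp, hTm⟩ := Theta_limits k P Θ₀ hΘ j s hs x₀ hx₀
  have hy : dot2 x₀ (nu2 P j) = 0 := by
    rw [hx₀]
    simp only [dot2, nu2, Real.cos_add_pi, Real.sin_add_pi]
    ring
  obtain ⟨hn1, hn2⟩ := side_neBot P j x₀ hy
  have hexp : ∀ (l : Filter (ℝ × ℝ)) (S : ℝ), Tendsto Θ₀ l (𝓝 S) →
      Tendsto (fun x : ℝ × ℝ => Complex.exp (Complex.I * (Θ₀ x : ℂ))) l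
        (𝓝 (Complex.exp (Complex.I * (S : ℂ)))) := by
    intro l S h
    have hc : Continuous (fun y : ℝ => Complex.exp (Complex.I * (y : ℂ))) := by fun_prop
    exact (hc.tendsto S).comp h
  have hEp := hexp _ _ hTp
  have hEm := hexp _ _ hTm
  have hLm : Complex.exp (Complex.I * ((T - 2 * Real.pi * P.rho j : ℝ) : ℂ)) =
      Complex.exp (-((2 * Real.pi * P.rho j : ℝ) : ℂ) * Complex.I) *
        Complex.exp (Complex.I * (T : ℂ)) := by
    rw [← Complex.exp_add]
    congr 1
    push_cast
    ring
  rw [hLm] at hEm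
  refine ⟨⟨_, hEp, hEm⟩, ?_⟩
  intro φ ψ φp ψp φm ψm hφp hψp hφm hψm
  have hof : ∀ (l : Filter (ℝ × ℝ)) (p q : ℝ), Tendsto φ l (𝓝 p) → Tendsto ψ l (𝓝 q) →
      Tendsto (fun x => (φ x : ℂ) + Complex.I * (ψ x : ℂ)) l
        (𝓝 ((p : ℂ) + Complex.I * (q : ℂ))) := by
    intro l p q hp hq
    exact ((Complex.continuous_ofReal.tendsto p).comp hp).add
      (((Complex.continuous_ofReal.tendsto q).comp hq).const_mul Complex.I)
  have hup := hEp.mul (hof _ _ _ hφp hψp)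
  have hum := hEm.mul (hof _ _ _ hφm hψm)
  have hne : Complex.exp (Complex.I * (T : ℂ)) ≠ 0 := Complex.exp_ne_zero _
  have hinv : Complex.exp (((2 * Real.pi * P.rho j : ℝ) : ℂ) * Complex.I) *
      Complex.exp (-((2 * Real.pi * P.rho j : ℝ) : ℂ) * Complex.I) = 1 := by
    rw [← Complex.exp_add, neg_mul, add_neg_cancel, Complex.exp_zero]
  constructor
  · constructor
    · rintro ⟨c, hc1, hc2⟩
      have e1 := tendsto_nhds_unique hup hc1
      have e2 := tendsto_nhds_unique hum hc2
      rw [← e1] at e2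
      apply mul_left_cancel₀ hne
      linear_combination
        Complex.exp (((2 * Real.pi * P.rho j : ℝ) : ℂ) * Complex.I) * e2
        - Complex.exp (Complex.I * (T : ℂ)) * ((φm : ℂ) + Complex.I * (ψm : ℂ)) * hinv
    · intro h
      refine ⟨_, hup, ?_⟩
      convert hum using 2
      rw [h]
      linear_combination
        -(Complex.exp (Complex.I * (T : ℂ)) * ((φp : ℂ) + Complex.I * (ψp : ℂ))) * hinv
  · rw [Complex.exp_mul_I, ← Complex.ofReal_cos, ← Complex.ofReal_sin, Complex.ext_iff]
    simp only [Complex.mul_re, Complex.add_re, Complex.add_im, Complex.mul_im,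
      Complex.ofReal_re, Complex.ofReal_im, Complex.I_re, Complex.I_im]
    constructor
    · rintro ⟨h1, h2⟩
      constructor <;> linarith
    · rintro ⟨h1, h2⟩
      constructor <;> linarith
end
end

section
/- Fix a pole configuration, let ρ := ρ¹+⋯+ρᵏ, and let m ∈ ℤ, β > 0, γ ∈ ℝ. Define the homogeneous profiles Φ₀, Ψ₀ : ℝ²∖{0} → ℝ in polar coordinates by Φ₀(r cos t, r sin t) := β r^{|m+ρ|} cos(2π f(t) + (m+ρ)(γ − t)) and Ψ₀(r cos t, r sin t) := β r^{|m+ρ|} sin(2π f(t) + (m+ρ)(γ − t)) for r > 0, t ∈ [0,2π). Then for every j ∈ {1,…,k} and every point x̄ = s·(cos(αʲ+π), sin(αʲ+π)) with s > 0 (i.e. every x̄ ∈ Γ₀^j∖{0}), the one-sided limits Φ₀⁺, Ψ₀⁺ of Φ₀, Ψ₀ as x → x̄ with x·ν^j > 0 and Φ₀⁻, Ψ₀⁻ as x → x̄ with x·ν^j < 0 exist and satisfy Φ₀⁻ = b_j Φ₀⁺ − d_j Ψ₀⁺ and Ψ₀⁻ = d_j Φ₀⁺ + b_j Ψ₀⁺;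 that is, the pair (Φ₀,Ψ₀) satisfies the transmission conditions R^j(Φ₀,Ψ₀) = I^j(Φ₀,Ψ₀) = 0 across every half-line Γ₀^j. -/
noncomputable section

open Real Set Filter Topology

/- STATEMENT 3: the homogeneous blow-up profiles Φ₀, Ψ₀ (case ρ ≠ 1/2 formulas, but valid
   for any m, β, γ) satisfy the transmission conditions R^j(Φ₀,Ψ₀) = I^j(Φ₀,Ψ₀) = 0 across
   every half-line Γ₀^j: the one-sided limits exist and are coupled by the rotation by 2πρʲ. -/

/-- Rotated complex coordinate. -/
def rotC (A : ℝ) (x : ℝ × ℝ) : ℂ :=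
  ⟨x.1 * Real.cos A + x.2 * Real.sin A, -x.1 * Real.sin A + x.2 * Real.cos A⟩

lemma rotC_continuous (A : ℝ) : Continuous (rotC A) := by
  have : rotC A = fun x : ℝ × ℝ => ((x.1 * Real.cos A + x.2 * Real.sin A : ℝ) : ℂ) +
      ((-x.1 * Real.sin A + x.2 * Real.cos A : ℝ) : ℂ) * Complex.I := by
    funext x
    exact (Complex.mk_eq_add_mul_I _ _)
  rw [this]
  fun_prop

lemma rotC_base (A s : ℝ) : rotC A (s * Real.cos A, s * Real.sin A) = (s : ℂ) := by
  apply Complex.ext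
  · simp only [rotC, Complex.ofReal_re]
    linear_combination s * Real.sin_sq_add_cos_sq A
  · simp only [rotC, Complex.ofReal_im]
    ring

lemma rotC_polar (A : ℝ) (x : ℝ × ℝ) :
    x = (‖rotC A x‖ * Real.cos (A + (rotC A x).arg),
      ‖rotC A x‖ * Real.sin (A + (rotC A x).arg)) := by
  have h1 := Complex.norm_mul_cos_arg (rotC A x)
  have h2 := Complex.norm_mul_sin_arg (rotC A x)
  have h3 : (rotC A x).re = x.1 * Real.cos A + x.2 * Real.sin A := rfl
  have h4 : (rotC A x).im = -x.1 * Real.sin A + x.2 * Real.cos A := rfl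
  rw [h3] at h1
  rw [h4] at h2
  apply Prod.ext
  · simp only [Real.cos_add]
    linear_combination (-x.1) * Real.sin_sq_add_cos_sq A - Real.cos A * h1 + Real.sin A * h2
  · simp only [Real.sin_add]
    linear_combination (-x.2) * Real.sin_sq_add_cos_sq A - Real.sin A * h1 - Real.cos A * h2

/-- One-sided limit along a filter finer than the neighbourhoods of the base point. -/
lemma tendsto_side (A s : ℝ) (hs : 0 < s) (l : Filter (ℝ × ℝ)) (S : Set ℝ)
    (hl : l ≤ 𝓝 (s * Real.cos A, s * Real.sin A))
    (hS : ∀ᶠ x in l, (rotC A x).arg ∈ S)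
    (G : ℝ × ℝ → ℝ) (p : ℝ) (hp : 0 ≤ p) (β : ℝ) (g h : ℝ → ℝ) (hc : Continuous h)
    (hG : ∀ r : ℝ, 0 < r → ∀ t ∈ Set.Ico (0 : ℝ) (2 * Real.pi),
      G (r * Real.cos t, r * Real.sin t) = β * r ^ p * g t)
    (hph : ∀ᶠ ε in 𝓝[S] (0 : ℝ), ∃ t ∈ Set.Ico (0 : ℝ) (2 * Real.pi),
      Real.cos t = Real.cos (A + ε) ∧ Real.sin t = Real.sin (A + ε) ∧ g t = h ε) :
    Tendsto G l (𝓝 (β * s ^ p * h 0)) := by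
  have hz : Tendsto (rotC A) l (𝓝 (s : ℂ)) := by
    have := (rotC_continuous A).tendsto (s * Real.cos A, s * Real.sin A)
    rw [rotC_base] at this
    exact this.mono_left hl
  have hr : Tendsto (fun x => ‖rotC A x‖) l (𝓝 s) := by
    have := hz.norm
    rwa [Complex.norm_real, Real.norm_of_nonneg hs.le] at this
  have hE : Tendsto (fun x => (rotC A x).arg) l (𝓝 0) := by
    have h0 : ContinuousAt Complex.arg (s : ℂ) :=
      Complex.continuousAt_arg (by simp [Complex.mem_slitPlane_iff, hs])
    have := h0.tendsto.comp hz
    rwa [Complex.arg_ofReal_of_nonneg hs.le] at this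
  have hE' : Tendsto (fun x => (rotC A x).arg) l (𝓝[S] 0) :=
    tendsto_nhdsWithin_iff.2 ⟨hE, hS⟩
  have hlim : Tendsto (fun x => β * ‖rotC A x‖ ^ p * h ((rotC A x).arg)) l
      (𝓝 (β * s ^ p * h 0)) :=
    ((hr.rpow_const (Or.inl hs.ne')).const_mul β).mul ((hc.tendsto 0).comp hE)
  refine hlim.congr' ?_
  filter_upwards [hE'.eventually hph, hr.eventually (lt_mem_nhds hs)] with x hx hrx
  obtain ⟨t, ht, h1, h2, h3⟩ := hx
  have := hG _ hrx t ht
  rw [h1, h2, ← rotC_polar A x, h3] at this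
  exact this.symm

lemma fStep_left {k : ℕ} (P : PoleConfig k) (j : Fin k) :
    ∀ᶠ ε in 𝓝[<] (0 : ℝ), fStep P (P.alpha j + Real.pi + ε) =
      ∑ i, P.rho i * (if P.alpha i < P.alpha j then 1 else 0) := by
  have : ∀ᶠ ε in 𝓝[<] (0 : ℝ), ∀ i, chiStep (P.alpha i) (P.alpha j + Real.pi + ε) =
      (if P.alpha i < P.alpha j then 1 else 0) := by
    rw [eventually_all]
    intro i
    by_cases h : P.alpha i < P.alpha j
    · have : ∀ᶠ ε in 𝓝[<] (0 : ℝ), P.alpha i - P.alpha j < ε :=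
        nhdsWithin_le_nhds (lt_mem_nhds (by linarith))
      filter_upwards [this] with ε hε
      rw [chiStep, if_pos (by linarith), if_pos h]
    · filter_upwards [self_mem_nhdsWithin] with ε hε
      have hε : ε < 0 := hε
      rw [chiStep, if_neg (by linarith), if_neg h]
  filter_upwards [this] with ε hε
  simp only [fStep, hε]

lemma fStep_right {k : ℕ} (P : PoleConfig k) (j : Fin k) :
    ∀ᶠ ε in 𝓝[>] (0 : ℝ), fStep P (P.alpha j + Real.pi + ε) =
      ∑ i, P.rho i * (if P.alpha i ≤ P.alpha j then 1 else 0) := by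
  have : ∀ᶠ ε in 𝓝[>] (0 : ℝ), ∀ i, chiStep (P.alpha i) (P.alpha j + Real.pi + ε) =
      (if P.alpha i ≤ P.alpha j then 1 else 0) := by
    rw [eventually_all]
    intro i
    by_cases h : P.alpha i ≤ P.alpha j
    · filter_upwards [self_mem_nhdsWithin] with ε hε
      have hε : 0 < ε := hε
      rw [chiStep, if_pos (by linarith), if_pos h]
    · have : ∀ᶠ ε in 𝓝[>] (0 : ℝ), ε < P.alpha i - P.alpha j :=
        nhdsWithin_le_nhds (gt_mem_nhds (by linarith))
      filter_upwards [this] with ε hε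
      rw [chiStep, if_neg (by linarith), if_neg h]
  filter_upwards [this] with ε hε
  simp only [fStep, hε]

lemma sum_le_eq {k : ℕ} (P : PoleConfig k) (j : Fin k) :
    ∑ i, P.rho i * (if P.alpha i ≤ P.alpha j then (1 : ℝ) else 0) =
      ∑ i, P.rho i * (if P.alpha i < P.alpha j then (1 : ℝ) else 0) + P.rho j := by
  have : P.rho j = ∑ i, if i = j then P.rho i else 0 := by simp
  rw [this, ← Finset.sum_add_distrib]
  refine Finset.sum_congr rfl fun i _ => ?_
  by_cases hij : i = j
  · subst hij; simp
  · have h := (P.alpha_distinct i j hij).1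
    simp [hij, le_iff_lt_or_eq, h]

lemma phase_left {k : ℕ} (P : PoleConfig k) (j : Fin k) (q γ : ℝ) :
    ∀ᶠ ε in 𝓝[<] (0 : ℝ), ∃ t ∈ Set.Ico (0 : ℝ) (2 * Real.pi), ∃ n : ℤ,
      Real.cos t = Real.cos (P.alpha j + Real.pi + ε) ∧
      Real.sin t = Real.sin (P.alpha j + Real.pi + ε) ∧
      2 * Real.pi * fStep P t + q * (γ - t) =
        2 * Real.pi * (∑ i, P.rho i * (if P.alpha i < P.alpha j then (1 : ℝ) else 0)) +
          q * (γ - (P.alpha j + Real.pi + ε)) + n * (2 * Real.pi) := by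
  have hm := P.alpha_mem j
  have : ∀ᶠ ε in 𝓝[<] (0 : ℝ), -(P.alpha j + Real.pi) < ε :=
    nhdsWithin_le_nhds (lt_mem_nhds (by linarith [hm.1]))
  filter_upwards [this, self_mem_nhdsWithin, fStep_left P j] with ε h1 h2 h3
  have h2 : ε < 0 := h2
  refine ⟨_, ⟨?_, ?_⟩, 0, rfl, rfl, ?_⟩
  · linarith
  · linarith [hm.2]
  · rw [h3]; simp

lemma phase_right {k : ℕ} (P : PoleConfig k) (j : Fin k) (m : ℤ) (γ : ℝ) :
    ∀ᶠ ε in 𝓝[>] (0 : ℝ), ∃ t ∈ Set.Ico (0 : ℝ) (2 * Real.pi), ∃ n : ℤ,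
      Real.cos t = Real.cos (P.alpha j + Real.pi + ε) ∧
      Real.sin t = Real.sin (P.alpha j + Real.pi + ε) ∧
      2 * Real.pi * fStep P t + ((m : ℝ) + ∑ i, P.rho i) * (γ - t) =
        2 * Real.pi * (∑ i, P.rho i * (if P.alpha i ≤ P.alpha j then (1 : ℝ) else 0)) +
          ((m : ℝ) + ∑ i, P.rho i) * (γ - (P.alpha j + Real.pi + ε)) + n * (2 * Real.pi) := by
  have hm := P.alpha_mem j
  rcases hm.2.lt_or_eq with hlt | heq
  · have : ∀ᶠ ε in 𝓝[>] (0 : ℝ), ε < Real.pi - P.alpha j :=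
      nhdsWithin_le_nhds (gt_mem_nhds (by linarith))
    filter_upwards [this, self_mem_nhdsWithin, fStep_right P j] with ε h1 h2 h3
    have h2 : 0 < ε := h2
    refine ⟨_, ⟨?_, ?_⟩, 0, rfl, rfl, ?_⟩
    · linarith [hm.1]
    · linarith
    · rw [h3]; simp
  · have hsmall : ∀ᶠ ε in 𝓝[>] (0 : ℝ), ∀ i, ε < P.alpha i + Real.pi := by
      rw [eventually_all]
      intro i
      exact nhdsWithin_le_nhds (gt_mem_nhds (by linarith [(P.alpha_mem i).1]))
    filter_upwards [hsmall, self_mem_nhdsWithin] with ε h1 h2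
    have h2 : 0 < ε := h2
    have hj := h1 j
    rw [heq] at hj
    have hA : P.alpha j + Real.pi + ε = ε + 2 * Real.pi := by rw [heq]; ring
    refine ⟨ε, ⟨h2.le, by linarith⟩, m, ?_, ?_, ?_⟩
    · rw [hA, Real.cos_add_two_pi]
    · rw [hA, Real.sin_add_two_pi]
    · have hf : fStep P ε = 0 := by
        refine Finset.sum_eq_zero fun i _ => ?_
        rw [chiStep, if_neg (not_le.2 (h1 i)), mul_zero]
      have hsum : ∑ i, P.rho i * (if P.alpha i ≤ P.alpha j then (1 : ℝ) else 0) =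
          ∑ i, P.rho i := by
        refine Finset.sum_congr rfl fun i _ => ?_
        rw [heq, if_pos (P.alpha_mem i).2, mul_one]
      rw [hf, hsum, hA]
      ring

theorem profile_transmission
    (k : ℕ) (P : PoleConfig k) (m : ℤ) (β γ : ℝ) (hβ : 0 < β)
    (Φ₀ Ψ₀ : ℝ × ℝ → ℝ)
    (hΦ : ∀ r : ℝ, 0 < r → ∀ t ∈ Set.Ico (0 : ℝ) (2 * Real.pi),
      Φ₀ (r * Real.cos t, r * Real.sin t) =
        β * r ^ |(m : ℝ) + ∑ i, P.rho i| *
          Real.cos (2 * Real.pi * fStep P t + ((m : ℝ) + ∑ i, P.rho i) * (γ - t)))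
    (hΨ : ∀ r : ℝ, 0 < r → ∀ t ∈ Set.Ico (0 : ℝ) (2 * Real.pi),
      Ψ₀ (r * Real.cos t, r * Real.sin t) =
        β * r ^ |(m : ℝ) + ∑ i, P.rho i| *
          Real.sin (2 * Real.pi * fStep P t + ((m : ℝ) + ∑ i, P.rho i) * (γ - t)))
    (j : Fin k) (s : ℝ) (hs : 0 < s) (x₀ : ℝ × ℝ)
    (hx₀ : x₀ = (s * Real.cos (P.alpha j + Real.pi), s * Real.sin (P.alpha j + Real.pi))) :
    ∃ Φp Ψp Φm Ψm : ℝ,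
      Filter.Tendsto Φ₀ (plusSide P j x₀) (nhds Φp) ∧
      Filter.Tendsto Ψ₀ (plusSide P j x₀) (nhds Ψp) ∧
      Filter.Tendsto Φ₀ (minusSide P j x₀) (nhds Φm) ∧
      Filter.Tendsto Ψ₀ (minusSide P j x₀) (nhds Ψm) ∧
      Φm = Real.cos (2 * Real.pi * P.rho j) * Φp - Real.sin (2 * Real.pi * P.rho j) * Ψp ∧
      Ψm = Real.sin (2 * Real.pi * P.rho j) * Φp + Real.cos (2 * Real.pi * P.rho j) * Ψp := by
  subst hx₀
  set A := P.alpha j + Real.pi with hA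
  have hsA : Real.sin A = -Real.sin (P.alpha j) := Real.sin_add_pi _
  have hcA : Real.cos A = -Real.cos (P.alpha j) := Real.cos_add_pi _
  have him : ∀ x : ℝ × ℝ, (rotC A x).im = -dot2 x (nu2 P j) := by
    intro x
    simp only [rotC, dot2, nu2, hsA, hcA]
    ring
  have hp : 0 ≤ |(m : ℝ) + ∑ i, P.rho i| := abs_nonneg _
  have hSp : ∀ᶠ x in plusSide P j (s * Real.cos A, s * Real.sin A),
      (rotC A x).arg ∈ Set.Iio (0 : ℝ) := by
    filter_upwards [self_mem_nhdsWithin] with x hx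
    have hx : 0 < dot2 x (nu2 P j) := hx
    exact Complex.arg_neg_iff.2 (by rw [him]; linarith)
  have hSm : ∀ᶠ x in minusSide P j (s * Real.cos A, s * Real.sin A),
      (rotC A x).arg ∈ Set.Ioi (0 : ℝ) := by
    filter_upwards [self_mem_nhdsWithin] with x hx
    have hx : dot2 x (nu2 P j) < 0 := hx
    have hi : 0 < (rotC A x).im := by rw [him]; linarith
    refine lt_of_le_of_ne (Complex.arg_nonneg_iff.2 hi.le) fun h0 => ?_
    exact hi.ne' (Complex.arg_eq_zero_iff.1 h0.symm).2
  have hL := phase_left P j ((m : ℝ) + ∑ i, P.rho i) γ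
  have hR := phase_right P j m γ
  rw [sum_le_eq] at hR
  rw [← hA] at hL hR
  generalize (∑ i, P.rho i * (if P.alpha i < P.alpha j then (1 : ℝ) else 0)) = F at hL hR
  generalize hq : (m : ℝ) + ∑ i, P.rho i = q at *
  refine ⟨_, _, _, _,
    tendsto_side A s hs _ _ nhdsWithin_le_nhds hSp Φ₀ |q| hp β _
      (fun ε => Real.cos (2 * Real.pi * F + q * (γ - (A + ε)))) (by fun_prop) hΦ ?_,
    tendsto_side A s hs _ _ nhdsWithin_le_nhds hSp Ψ₀ |q| hp β _
      (fun ε => Real.sin (2 * Real.pi * F + q * (γ - (A + ε)))) (by fun_prop) hΨ ?_,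
    tendsto_side A s hs _ _ nhdsWithin_le_nhds hSm Φ₀ |q| hp β _
      (fun ε => Real.cos (2 * Real.pi * (F + P.rho j) + q * (γ - (A + ε)))) (by fun_prop) hΦ ?_,
    tendsto_side A s hs _ _ nhdsWithin_le_nhds hSm Ψ₀ |q| hp β _
      (fun ε => Real.sin (2 * Real.pi * (F + P.rho j) + q * (γ - (A + ε)))) (by fun_prop) hΨ ?_,
    ?_, ?_⟩
  · filter_upwards [hL] with ε ⟨t, ht, n, h1, h2, h3⟩
    exact ⟨t, ht, h1, h2, by rw [h3, Real.cos_add_int_mul_two_pi]⟩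
  · filter_upwards [hL] with ε ⟨t, ht, n, h1, h2, h3⟩
    exact ⟨t, ht, h1, h2, by rw [h3, Real.sin_add_int_mul_two_pi]⟩
  · filter_upwards [hR] with ε ⟨t, ht, n, h1, h2, h3⟩
    exact ⟨t, ht, h1, h2, by rw [h3, Real.cos_add_int_mul_two_pi]⟩
  · filter_upwards [hR] with ε ⟨t, ht, n, h1, h2, h3⟩
    exact ⟨t, ht, h1, h2, by rw [h3, Real.sin_add_int_mul_two_pi]⟩
  · have : 2 * Real.pi * (F + P.rho j) + q * (γ - (A + 0)) =
        2 * Real.pi * P.rho j + (2 * Real.pi * F + q * (γ - (A + 0))) := by ring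
    simp only [this, Real.cos_add (2 * Real.pi * P.rho j)]
    ring
  · have : 2 * Real.pi * (F + P.rho j) + q * (γ - (A + 0)) =
        2 * Real.pi * P.rho j + (2 * Real.pi * F + q * (γ - (A + 0))) := by ring
    simp only [this, Real.sin_add (2 * Real.pi * P.rho j)]
    ring
end
end

section
/- Fix a pole configuration with ρ := ρ¹+⋯+ρᵏ = 1/2, and let m ∈ ℕ, β > 0, γ ∈ ℝ. Define Φ₀, Ψ₀ : ℝ²∖{0} → ℝ in polar coordinates by Φ₀(r cos t, r sin t) := β r^{m+1/2} cos(2π f(t)) cos((m+1/2)(γ + t)) and Ψ₀(r cos t, r sin t) := β r^{m+1/2} sin(2π f(t)) cos((m+1/2)(γ + t)) for r > 0, t ∈ [0,2π). Then for every j ∈ {1,…,k} and every point x̄ = s·(cos(αʲ+π), sin(αʲ+π)) with s > 0, the one-sided limits Φ₀⁺, Ψ₀⁺ of Φ₀, Ψ₀ as x → x̄ with x·ν^j > 0 and Φ₀⁻, Ψ₀⁻ as x → x̄ with x·ν^j < 0 exist and satisfy Φ₀⁻ = b_j Φ₀⁺ − d_j Ψ₀⁺ and Ψ₀⁻ = d_j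 Φ₀⁺ + b_j Ψ₀⁺; that is, the pair (Φ₀,Ψ₀) satisfies the transmission conditions R^j(Φ₀,Ψ₀) = I^j(Φ₀,Ψ₀) = 0 across every half-line Γ₀^j. -/
noncomputable section

open Real Set Filter Topology

/- STATEMENT 4: in the half-integer case ρ = 1/2, the blow-up profiles
   Φ₀ = β r^{m+1/2} cos(2πf(t)) cos((m+1/2)(γ+t)) and
   Ψ₀ = β r^{m+1/2} sin(2πf(t)) cos((m+1/2)(γ+t))
   satisfy the transmission conditions R^j(Φ₀,Ψ₀) = I^j(Φ₀,Ψ₀) = 0 across every Γ₀^j. -/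

theorem chi_left (a T : ℝ) :
    ∀ᶠ t in 𝓝[<] T, chiStep a t = if a + π < T then 1 else 0 := by
  by_cases h : a + π < T
  · have : ∀ᶠ t in 𝓝[<] T, a + π < t := nhdsWithin_le_nhds (lt_mem_nhds h)
    filter_upwards [this] with t ht
    simp [chiStep, h, ht.le]
  · filter_upwards [self_mem_nhdsWithin] with t ht
    have h2 : ¬ (a + π ≤ t) := fun h3 => h (lt_of_le_of_lt h3 ht)
    simp only [chiStep, if_neg h, if_neg h2]

theorem chi_right (a T : ℝ) :
    ∀ᶠ t in 𝓝[>] T, chiStep a t = if a + π ≤ T then 1 else 0 := by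
  by_cases h : a + π ≤ T
  · filter_upwards [self_mem_nhdsWithin] with t ht
    have h2 : a + π ≤ t := h.trans (le_of_lt ht)
    simp only [chiStep, if_pos h, if_pos h2]
  · have : ∀ᶠ t in 𝓝[>] T, t < a + π := nhdsWithin_le_nhds (gt_mem_nhds (not_le.1 h))
    filter_upwards [this] with t ht
    simp only [chiStep, if_neg h, if_neg (not_le.2 ht)]

theorem f_left {k : ℕ} (P : PoleConfig k) (T : ℝ) :
    ∀ᶠ t in 𝓝[<] T, fStep P t = ∑ i, P.rho i * (if P.alpha i + π < T then 1 else 0) := by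
  have := eventually_all.2 (fun i => chi_left (P.alpha i) T)
  filter_upwards [this] with t ht
  simp only [fStep, ht]

theorem f_right {k : ℕ} (P : PoleConfig k) (T : ℝ) :
    ∀ᶠ t in 𝓝[>] T, fStep P t = ∑ i, P.rho i * (if P.alpha i + π ≤ T then 1 else 0) := by
  have := eventually_all.2 (fun i => chi_right (P.alpha i) T)
  filter_upwards [this] with t ht
  simp only [fStep, ht]

/-- Limit of a profile along a filter on which the polar angle tends to `T` one-sidedly. -/
theorem profile_lim {k : ℕ} (P : PoleConfig k) (p β γ : ℝ) (G : ℝ → ℝ) (Φ : ℝ × ℝ → ℝ)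
    (hΦ : ∀ r : ℝ, 0 < r → ∀ t ∈ Set.Ico (0 : ℝ) (2 * π),
      Φ (r * cos t, r * sin t) = β * r ^ p * G (2 * π * fStep P t) * cos (p * (γ + t)))
    (l : Filter (ℝ × ℝ)) (r t : ℝ × ℝ → ℝ) (s T F : ℝ) (S : Set ℝ) (hs : 0 < s)
    (hr : Tendsto r l (𝓝 s)) (ht : Tendsto t l (𝓝[S] T))
    (hx : ∀ᶠ x in l, x = (r x * cos (t x), r x * sin (t x)))
    (hI : ∀ᶠ u in 𝓝[S] T, u ∈ Set.Ico (0 : ℝ) (2 * π))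
    (hF : ∀ᶠ u in 𝓝[S] T, fStep P u = F) :
    Tendsto Φ l (𝓝 (β * s ^ p * G (2 * π * F) * cos (p * (γ + T)))) := by
  have ht' : Tendsto t l (𝓝 T) := ht.mono_right nhdsWithin_le_nhds
  have h1 : Tendsto (fun x => β * r x ^ p * G (2 * π * F) * cos (p * (γ + t x))) l
      (𝓝 (β * s ^ p * G (2 * π * F) * cos (p * (γ + T)))) := by
    refine Tendsto.mul (Tendsto.mul (Tendsto.mul tendsto_const_nhds ?_) tendsto_const_nhds) ?_
    · exact hr.rpow_const (Or.inl hs.ne')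
    · have hc : Continuous fun u : ℝ => cos (p * (γ + u)) := by fun_prop
      exact (hc.tendsto T).comp ht'
  refine h1.congr' ?_
  filter_upwards [hx, ht.eventually hI, ht.eventually hF, hr.eventually (lt_mem_nhds hs)]
    with x h1 h2 h3 h4
  conv_rhs => rw [h1]
  rw [hΦ _ h4 _ h2, h3]

/-- Local polar coordinates around a point of the half-line of angle `a + π`. -/
def radius (x : ℝ × ℝ) : ℝ := √(x.1 ^ 2 + x.2 ^ 2)

def uu (a : ℝ) (x : ℝ × ℝ) : ℝ := -(x.1 * cos a + x.2 * sin a)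

def vv (a : ℝ) (x : ℝ × ℝ) : ℝ := -(x.1 * (-sin a) + x.2 * cos a)

def theta (a : ℝ) (x : ℝ × ℝ) : ℝ := arctan (vv a x / uu a x)

theorem uu_x0 (a s : ℝ) : uu a (s * cos (a + π), s * sin (a + π)) = s := by
  simp only [uu, cos_add_pi, sin_add_pi]
  linear_combination s * sin_sq_add_cos_sq a

theorem vv_x0 (a s : ℝ) : vv a (s * cos (a + π), s * sin (a + π)) = 0 := by
  simp only [vv, cos_add_pi, sin_add_pi]
  ring

theorem radius_x0 (a s : ℝ) (hs : 0 < s) :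
    radius (s * cos (a + π), s * sin (a + π)) = s := by
  have : (s * cos (a + π)) ^ 2 + (s * sin (a + π)) ^ 2 = s ^ 2 := by
    linear_combination s ^ 2 * sin_sq_add_cos_sq (a + π)
  simp only [radius, this, sqrt_sq hs.le]

theorem radius_tendsto (a s : ℝ) (hs : 0 < s) :
    Tendsto radius (𝓝 (s * cos (a + π), s * sin (a + π))) (𝓝 s) := by
  have hc : Continuous radius := by unfold radius; fun_prop
  have := hc.tendsto (s * cos (a + π), s * sin (a + π))
  rwa [radius_x0 a s hs] at this

theorem theta_tendsto (a s : ℝ) (hs : 0 < s) :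
    Tendsto (theta a) (𝓝 (s * cos (a + π), s * sin (a + π))) (𝓝 0) := by
  have hu : Continuous (uu a) := by unfold uu; fun_prop
  have hv : Continuous (vv a) := by unfold vv; fun_prop
  have h1 := hu.tendsto (s * cos (a + π), s * sin (a + π))
  have h2 := hv.tendsto (s * cos (a + π), s * sin (a + π))
  rw [uu_x0] at h1
  rw [vv_x0] at h2
  have h3 := (continuous_arctan.tendsto _).comp (h2.div h1 hs.ne')
  rw [zero_div, arctan_zero] at h3
  exact h3

theorem uu_pos_ev (a s : ℝ) (hs : 0 < s) :
    ∀ᶠ x in 𝓝 (s * cos (a + π), s * sin (a + π)), 0 < uu a x := by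
  have hu : Continuous (uu a) := by unfold uu; fun_prop
  have h1 := hu.tendsto (s * cos (a + π), s * sin (a + π))
  rw [uu_x0] at h1
  exact h1.eventually (lt_mem_nhds hs)

theorem polar_eq (a : ℝ) (x : ℝ × ℝ) (hu : 0 < uu a x) :
    x = (radius x * cos (a + π + theta a x), radius x * sin (a + π + theta a x)) := by
  have hR : radius x = uu a x * √(1 + (vv a x / uu a x) ^ 2) := by
    have : x.1 ^ 2 + x.2 ^ 2 = (uu a x) ^ 2 * (1 + (vv a x / uu a x) ^ 2) := by
      have h1 : (uu a x) ^ 2 * (1 + (vv a x / uu a x) ^ 2) = uu a x ^ 2 + vv a x ^ 2 := by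
        field_simp
      rw [h1, uu, vv]
      linear_combination (-(x.1 ^ 2 + x.2 ^ 2)) * sin_sq_add_cos_sq a
    rw [radius, this, sqrt_mul (sq_nonneg _), sqrt_sq hu.le]
  have hq : √(1 + (vv a x / uu a x) ^ 2) ≠ 0 := by positivity
  have hc : radius x * cos (theta a x) = uu a x := by
    rw [hR, theta, cos_arctan]
    field_simp
  have hsn : radius x * sin (theta a x) = vv a x := by
    rw [hR, theta, sin_arctan]
    field_simp
  have e : a + π + theta a x = a + theta a x + π := by ring
  rw [e, cos_add_pi, sin_add_pi, cos_add, sin_add]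
  rw [uu] at hc
  rw [vv] at hsn
  ext
  · simp only
    linear_combination cos a * hc - sin a * hsn - x.1 * sin_sq_add_cos_sq a
  · simp only
    linear_combination sin a * hc + cos a * hsn - x.2 * sin_sq_add_cos_sq a

theorem theta_left (a c s : ℝ) (hs : 0 < s) :
    Tendsto (fun x => c + theta a x)
      (𝓝[{x | vv a x < 0}] (s * cos (a + π), s * sin (a + π))) (𝓝[<] c) := by
  refine tendsto_nhdsWithin_iff.2 ⟨?_, ?_⟩
  · have := (theta_tendsto a s hs).const_add c
    rw [add_zero] at this
    exact this.mono_left nhdsWithin_le_nhds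
  · filter_upwards [self_mem_nhdsWithin, nhdsWithin_le_nhds (uu_pos_ev a s hs)] with x h1 h2
    have : theta a x < 0 := by
      rw [theta, ← arctan_zero]
      exact arctan_strictMono (div_neg_of_neg_of_pos h1 h2)
    simp only [Set.mem_Iio]; linarith

theorem theta_right (a c s : ℝ) (hs : 0 < s) :
    Tendsto (fun x => c + theta a x)
      (𝓝[{x | 0 < vv a x}] (s * cos (a + π), s * sin (a + π))) (𝓝[>] c) := by
  refine tendsto_nhdsWithin_iff.2 ⟨?_, ?_⟩
  · have := (theta_tendsto a s hs).const_add c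
    rw [add_zero] at this
    exact this.mono_left nhdsWithin_le_nhds
  · filter_upwards [self_mem_nhdsWithin, nhdsWithin_le_nhds (uu_pos_ev a s hs)] with x h1 h2
    have : 0 < theta a x := by
      rw [theta, ← arctan_zero]
      exact arctan_strictMono (div_pos h1 h2)
    simp only [Set.mem_Ioi]; linarith

theorem sum_jump {k : ℕ} (P : PoleConfig k) (j : Fin k) :
    ∑ i, P.rho i * (if P.alpha i + π ≤ P.alpha j + π then (1 : ℝ) else 0) =
      (∑ i, P.rho i * (if P.alpha i + π < P.alpha j + π then (1 : ℝ) else 0)) + P.rho j := by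
  have : P.rho j = ∑ i, if i = j then P.rho i else 0 := by simp
  rw [this, ← Finset.sum_add_distrib]
  refine Finset.sum_congr rfl fun i _ => ?_
  by_cases h : i = j
  · subst h; simp
  · have hne := (P.alpha_distinct i j h).1
    have : (P.alpha i + π ≤ P.alpha j + π) ↔ (P.alpha i + π < P.alpha j + π) := by
      rw [add_le_add_iff_right, add_lt_add_iff_right]
      exact ⟨fun h => lt_of_le_of_ne h hne, le_of_lt⟩
    simp [this, h]

theorem profile_transmission_half_integer
    (k : ℕ) (P : PoleConfig k) (hρ : (∑ i, P.rho i) = 1 / 2)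
    (m : ℕ) (β γ : ℝ) (hβ : 0 < β)
    (Φ₀ Ψ₀ : ℝ × ℝ → ℝ)
    (hΦ : ∀ r : ℝ, 0 < r → ∀ t ∈ Set.Ico (0 : ℝ) (2 * Real.pi),
      Φ₀ (r * Real.cos t, r * Real.sin t) =
        β * r ^ ((m : ℝ) + 1 / 2) * Real.cos (2 * Real.pi * fStep P t) *
          Real.cos (((m : ℝ) + 1 / 2) * (γ + t)))
    (hΨ : ∀ r : ℝ, 0 < r → ∀ t ∈ Set.Ico (0 : ℝ) (2 * Real.pi),
      Ψ₀ (r * Real.cos t, r * Real.sin t) =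
        β * r ^ ((m : ℝ) + 1 / 2) * Real.sin (2 * Real.pi * fStep P t) *
          Real.cos (((m : ℝ) + 1 / 2) * (γ + t)))
    (j : Fin k) (s : ℝ) (hs : 0 < s) (x₀ : ℝ × ℝ)
    (hx₀ : x₀ = (s * Real.cos (P.alpha j + Real.pi), s * Real.sin (P.alpha j + Real.pi))) :
    ∃ Φp Ψp Φm Ψm : ℝ,
      Filter.Tendsto Φ₀ (plusSide P j x₀) (nhds Φp) ∧
      Filter.Tendsto Ψ₀ (plusSide P j x₀) (nhds Ψp) ∧
      Filter.Tendsto Φ₀ (minusSide P j x₀) (nhds Φm) ∧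
      Filter.Tendsto Ψ₀ (minusSide P j x₀) (nhds Ψm) ∧
      Φm = Real.cos (2 * Real.pi * P.rho j) * Φp - Real.sin (2 * Real.pi * P.rho j) * Ψp ∧
      Ψm = Real.sin (2 * Real.pi * P.rho j) * Φp + Real.cos (2 * Real.pi * P.rho j) * Ψp := by
  subst hx₀
  set a := P.alpha j with ha
  set x₀ : ℝ × ℝ := (s * cos (a + π), s * sin (a + π)) with hx₀
  set p : ℝ := (m : ℝ) + 1 / 2 with hp
  have hpi := pi_pos
  have hmem := P.alpha_mem j
  rw [← ha] at hmem
  have eP : plusSide P j x₀ = 𝓝[{x | vv a x < 0}] x₀ := by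
    simp only [plusSide, dot2, nu2, vv, neg_lt_zero, ← ha]
  have eM : minusSide P j x₀ = 𝓝[{x | 0 < vv a x}] x₀ := by
    simp only [minusSide, dot2, nu2, vv, neg_pos, ← ha]
  set F := ∑ i, P.rho i * (if P.alpha i + π < a + π then (1 : ℝ) else 0) with hF
  have hrad := radius_tendsto a s hs
  have hpol : ∀ᶠ x in 𝓝 x₀,
      x = (radius x * cos (a + π + theta a x), radius x * sin (a + π + theta a x)) :=
    (uu_pos_ev a s hs).mono fun x hx => polar_eq a x hx
  have hI : ∀ᶠ u in 𝓝[<] (a + π), u ∈ Set.Ico (0 : ℝ) (2 * π) := by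
    have h0 : (0 : ℝ) < a + π := by linarith [hmem.1]
    filter_upwards [self_mem_nhdsWithin, nhdsWithin_le_nhds (lt_mem_nhds h0)] with u h1 h2
    have h1' : u < a + π := h1
    exact ⟨h2.le, by linarith [hmem.2]⟩
  have plus := fun (G : ℝ → ℝ) Φ hΦ => profile_lim P p β γ G Φ hΦ (plusSide P j x₀) radius
    (fun x => a + π + theta a x) s (a + π) F (Set.Iio (a + π)) hs
    (by rw [eP]; exact hrad.mono_left nhdsWithin_le_nhds)
    (by rw [eP]; exact theta_left a (a + π) s hs)
    (by rw [eP]; exact nhdsWithin_le_nhds hpol) hI (f_left P (a + π))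
  rcases hmem.2.lt_or_eq with hlt | heq
  · have hI' : ∀ᶠ u in 𝓝[>] (a + π), u ∈ Set.Ico (0 : ℝ) (2 * π) := by
      have h0 : a + π < 2 * π := by linarith
      filter_upwards [self_mem_nhdsWithin, nhdsWithin_le_nhds (gt_mem_nhds h0)] with u h1 h2
      have h1' : a + π < u := h1
      exact ⟨by linarith [hmem.1], h2⟩
    have minus := fun (G : ℝ → ℝ) Φ hΦ => profile_lim P p β γ G Φ hΦ (minusSide P j x₀) radius
      (fun x => a + π + theta a x) s (a + π) (F + P.rho j) (Set.Ioi (a + π)) hs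
      (by rw [eM]; exact hrad.mono_left nhdsWithin_le_nhds)
      (by rw [eM]; exact theta_right a (a + π) s hs)
      (by rw [eM]; exact nhdsWithin_le_nhds hpol) hI'
      (by rw [hF, ← sum_jump P j]; exact f_right P (a + π))
    refine ⟨_, _, _, _, plus cos Φ₀ hΦ, plus sin Ψ₀ hΨ, minus cos Φ₀ hΦ, minus sin Ψ₀ hΨ, ?_, ?_⟩
    · rw [mul_add, cos_add]; ring
    · rw [mul_add, sin_add]; ring
  · have hI' : ∀ᶠ u in 𝓝[>] (0 : ℝ), u ∈ Set.Ico (0 : ℝ) (2 * π) := by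
      have h0 : (0 : ℝ) < 2 * π := by linarith
      filter_upwards [self_mem_nhdsWithin, nhdsWithin_le_nhds (gt_mem_nhds h0)] with u h1 h2
      exact ⟨le_of_lt h1, h2⟩
    have hpol' : ∀ᶠ x in 𝓝 x₀,
        x = (radius x * cos (0 + theta a x), radius x * sin (0 + theta a x)) := by
      filter_upwards [hpol] with x hx
      have e : a + π + theta a x = (0 + theta a x) + 2 * π := by rw [heq]; ring
      rwa [e, cos_add_two_pi, sin_add_two_pi] at hx
    have hF0 : ∀ᶠ u in 𝓝[>] (0 : ℝ), fStep P u = 0 := by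
      have h := f_right P 0
      have h0 : ∑ i, P.rho i * (if P.alpha i + π ≤ 0 then (1 : ℝ) else 0) = 0 := by
        refine Finset.sum_eq_zero fun i _ => ?_
        have : ¬ (P.alpha i + π ≤ 0) := by linarith [(P.alpha_mem i).1]
        simp [this]
      rwa [h0] at h
    have minus := fun (G : ℝ → ℝ) Φ hΦ => profile_lim P p β γ G Φ hΦ (minusSide P j x₀) radius
      (fun x => 0 + theta a x) s 0 0 (Set.Ioi 0) hs
      (by rw [eM]; exact hrad.mono_left nhdsWithin_le_nhds)
      (by rw [eM]; exact theta_right a 0 s hs)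
      (by rw [eM]; exact nhdsWithin_le_nhds hpol') hI' hF0
    have hFv : F = 1 / 2 - P.rho j := by
      have h := sum_jump P j
      rw [← ha, ← hF] at h
      have h0 : ∑ i, P.rho i * (if P.alpha i + π ≤ a + π then (1 : ℝ) else 0) = 1 / 2 := by
        rw [← hρ]
        refine Finset.sum_congr rfl fun i _ => ?_
        have : P.alpha i + π ≤ a + π := by linarith [(P.alpha_mem i).2]
        simp [this]
      linarith
    have hcos : cos (p * (γ + (a + π))) = -cos (p * (γ + 0)) := by
      have e : p * (γ + (a + π)) = p * (γ + 0) + π + (m : ℤ) * (2 * π) := by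
        rw [heq, hp]; push_cast; ring
      rw [e, cos_add_int_mul_two_pi, cos_add_pi]
    have hcF : cos (2 * π * F) = -cos (2 * π * P.rho j) := by
      rw [hFv, show 2 * π * (1 / 2 - P.rho j) = π - 2 * π * P.rho j by ring, cos_pi_sub]
    have hsF : sin (2 * π * F) = sin (2 * π * P.rho j) := by
      rw [hFv, show 2 * π * (1 / 2 - P.rho j) = π - 2 * π * P.rho j by ring, sin_pi_sub]
    refine ⟨_, _, _, _, plus cos Φ₀ hΦ, plus sin Ψ₀ hΨ, minus cos Φ₀ hΦ, minus sin Ψ₀ hΨ, ?_, ?_⟩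
    · rw [hcos, hcF, hsF, mul_zero, cos_zero]
      linear_combination (-(β * s ^ p * cos (p * (γ + 0)))) * sin_sq_add_cos_sq (2 * π * P.rho j)
    · rw [hcos, hcF, hsF, mul_zero, sin_zero]
      ring
end
end

section
/- Fix a pole configuration, let ρ := ρ¹+⋯+ρᵏ, let Θ₀ be the associated multi-angle potential, and let m ∈ ℤ, β > 0, γ ∈ ℝ with profiles Φ₀, Ψ₀ defined by Φ₀(r cos t, r sin t) := β r^{|m+ρ|} cos(2π f(t) + (m+ρ)(γ − t)) and Ψ₀(r cos t, r sin t) := β r^{|m+ρ|} sin(2π f(t) + (m+ρ)(γ − t)) for r > 0, t ∈ [0,2π). Then: (i) Θ₀(r cos t, r sin t) = ρ·t − 2π f(t) + πρ − Σⱼ ρʲαʲ for every r > 0 and t ∈ [0,2π); (ii) for every r > 0 and t ∈ [0,2π), exp(i·Θ₀(r cos t, r sin t))·(Φ₀ + iΨ₀)(r cos t, r sin t) = β·exp(i·((m+ρ)γ + πρ − Σⱼ ρʲαʲ))·r^{|m+ρ|}·e^{−imt}. In particular, the gauged profile e^{iΘ₀}(Φ₀ + iΨ₀) extends to a continuous function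 on ℝ²∖{0}. -/
noncomputable section

open Real Set Filter Topology

/- STATEMENT 5: the polar formula for the multi-angle potential Θ₀, the identity expressing
   the gauged profile e^{iΘ₀}(Φ₀+iΨ₀) as the homogeneous function c·r^{|m+ρ|}e^{−imt},
   and the continuity of the gauged profile on ℝ²∖{0}. -/

theorem gauged_profile_identity
    (k : ℕ) (P : PoleConfig k) (Θ₀ : ℝ × ℝ → ℝ)
    (hΘ : ∀ r : ℝ, 0 < r → ∀ t ∈ Set.Ico (0 : ℝ) (2 * Real.pi),
      Θ₀ (r * Real.cos t, r * Real.sin t) =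
        ∑ j, P.rho j * (-(P.alpha j) + t + Real.pi * (1 - 2 * chiStep (P.alpha j) t)))
    (m : ℤ) (β γ : ℝ) (hβ : 0 < β)
    (Φ₀ Ψ₀ : ℝ × ℝ → ℝ)
    (hΦ : ∀ r : ℝ, 0 < r → ∀ t ∈ Set.Ico (0 : ℝ) (2 * Real.pi),
      Φ₀ (r * Real.cos t, r * Real.sin t) =
        β * r ^ |(m : ℝ) + ∑ i, P.rho i| *
          Real.cos (2 * Real.pi * fStep P t + ((m : ℝ) + ∑ i, P.rho i) * (γ - t)))
    (hΨ : ∀ r : ℝ, 0 < r → ∀ t ∈ Set.Ico (0 : ℝ) (2 * Real.pi),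
      Ψ₀ (r * Real.cos t, r * Real.sin t) =
        β * r ^ |(m : ℝ) + ∑ i, P.rho i| *
          Real.sin (2 * Real.pi * fStep P t + ((m : ℝ) + ∑ i, P.rho i) * (γ - t))) :
    (∀ r : ℝ, 0 < r → ∀ t ∈ Set.Ico (0 : ℝ) (2 * Real.pi),
      Θ₀ (r * Real.cos t, r * Real.sin t) =
        (∑ i, P.rho i) * t - 2 * Real.pi * fStep P t + Real.pi * (∑ i, P.rho i) -
          ∑ i, P.rho i * P.alpha i) ∧
    (∀ r : ℝ, 0 < r → ∀ t ∈ Set.Ico (0 : ℝ) (2 * Real.pi),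
      Complex.exp (Complex.I * (Θ₀ (r * Real.cos t, r * Real.sin t) : ℂ)) *
          ((Φ₀ (r * Real.cos t, r * Real.sin t) : ℂ) +
            Complex.I * (Ψ₀ (r * Real.cos t, r * Real.sin t) : ℂ)) =
        (β : ℂ) *
          Complex.exp (Complex.I *
            ((((m : ℝ) + ∑ i, P.rho i) * γ + Real.pi * (∑ i, P.rho i) -
                ∑ i, P.rho i * P.alpha i : ℝ) : ℂ)) *
          ((r ^ |(m : ℝ) + ∑ i, P.rho i| : ℝ) : ℂ) *
          Complex.exp (-Complex.I * (m : ℂ) * (t : ℂ))) ∧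
    ContinuousOn (fun x : ℝ × ℝ =>
        Complex.exp (Complex.I * (Θ₀ x : ℂ)) * ((Φ₀ x : ℂ) + Complex.I * (Ψ₀ x : ℂ)))
      {x : ℝ × ℝ | x ≠ 0} := by
  have h1 : (∀ r : ℝ, 0 < r → ∀ t ∈ Set.Ico (0 : ℝ) (2 * Real.pi),
      Θ₀ (r * Real.cos t, r * Real.sin t) =
        (∑ i, P.rho i) * t - 2 * Real.pi * fStep P t + Real.pi * (∑ i, P.rho i) -
          ∑ i, P.rho i * P.alpha i) := by
    intro r hr t ht
    rw [hΘ r hr t ht, fStep, Finset.sum_mul, Finset.mul_sum, Finset.mul_sum,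
      ← Finset.sum_sub_distrib, ← Finset.sum_add_distrib, ← Finset.sum_sub_distrib]
    refine Finset.sum_congr rfl fun j _ => ?_
    ring
  have h2 : (∀ r : ℝ, 0 < r → ∀ t ∈ Set.Ico (0 : ℝ) (2 * Real.pi),
      Complex.exp (Complex.I * (Θ₀ (r * Real.cos t, r * Real.sin t) : ℂ)) *
          ((Φ₀ (r * Real.cos t, r * Real.sin t) : ℂ) +
            Complex.I * (Ψ₀ (r * Real.cos t, r * Real.sin t) : ℂ)) =
        (β : ℂ) *
          Complex.exp (Complex.I *
            ((((m : ℝ) + ∑ i, P.rho i) * γ + Real.pi * (∑ i, P.rho i) -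
                ∑ i, P.rho i * P.alpha i : ℝ) : ℂ)) *
          ((r ^ |(m : ℝ) + ∑ i, P.rho i| : ℝ) : ℂ) *
          Complex.exp (-Complex.I * (m : ℂ) * (t : ℂ))) := by
    intro r hr t ht
    rw [h1 r hr t ht, hΦ r hr t ht, hΨ r hr t ht]
    generalize (∑ i, P.rho i) = ρ
    generalize (∑ i, P.rho i * P.alpha i) = A
    generalize fStep P t = F
    generalize r ^ |(m : ℝ) + ρ| = R
    have e : ∀ u : ℝ, ((β * R * Real.cos u : ℝ) : ℂ) + Complex.I * ((β * R * Real.sin u : ℝ) : ℂ)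
        = β * R * Complex.exp (Complex.I * u) := by
      intro u
      rw [mul_comm Complex.I (u : ℂ), Complex.exp_mul_I]
      push_cast
      ring
    rw [e]
    have e2 : ∀ a b c d : ℂ, Complex.I * a + Complex.I * b = Complex.I * c + d →
        Complex.exp (Complex.I * a) * (β * R * Complex.exp (Complex.I * b)) =
        β * Complex.exp (Complex.I * c) * R * Complex.exp d := by
      intro a b c d h
      have := congrArg Complex.exp h
      rw [Complex.exp_add, Complex.exp_add] at this
      linear_combination (β * R : ℂ) * this
    apply e2
    push_cast
    ring
  refine ⟨h1, h2, ?_⟩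
  have key : ∀ x : ℝ × ℝ, x ≠ 0 → ∃ r : ℝ, 0 < r ∧ ∃ t ∈ Set.Ico (0 : ℝ) (2 * Real.pi),
      x = (r * Real.cos t, r * Real.sin t) := by
    intro x hx
    have hz : (⟨x.1, x.2⟩ : ℂ) ≠ 0 := by
      intro h
      apply hx
      have ha := congrArg Complex.re h
      have hb := congrArg Complex.im h
      exact Prod.ext ha hb
    refine ⟨‖(⟨x.1, x.2⟩ : ℂ)‖, norm_pos_iff.mpr hz,
      toIcoMod Real.two_pi_pos 0 (Complex.arg ⟨x.1, x.2⟩), ?_, ?_⟩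
    · simpa using toIcoMod_mem_Ico Real.two_pi_pos 0 (Complex.arg ⟨x.1, x.2⟩)
    · have hc : Real.cos (toIcoMod Real.two_pi_pos 0 (Complex.arg ⟨x.1, x.2⟩)) =
          Real.cos (Complex.arg ⟨x.1, x.2⟩) := by
        rw [toIcoMod, zsmul_eq_mul, Real.cos_sub_int_mul_two_pi]
      have hs : Real.sin (toIcoMod Real.two_pi_pos 0 (Complex.arg ⟨x.1, x.2⟩)) =
          Real.sin (Complex.arg ⟨x.1, x.2⟩) := by
        rw [toIcoMod, zsmul_eq_mul, Real.sin_sub_int_mul_two_pi]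
      rw [hc, hs, Complex.norm_mul_cos_arg, Complex.norm_mul_sin_arg]
  set C : ℂ := (β : ℂ) *
          Complex.exp (Complex.I *
            ((((m : ℝ) + ∑ i, P.rho i) * γ + Real.pi * (∑ i, P.rho i) -
                ∑ i, P.rho i * P.alpha i : ℝ) : ℂ)) with hC
  have hcont : ContinuousOn (fun x : ℝ × ℝ =>
      C * ((Real.sqrt (x.1 ^ 2 + x.2 ^ 2) ^ |(m : ℝ) + ∑ i, P.rho i| : ℝ) : ℂ) *
        (((x.1 : ℂ) + x.2 * Complex.I) / (Real.sqrt (x.1 ^ 2 + x.2 ^ 2) : ℂ)) ^ (-m))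
      {x : ℝ × ℝ | x ≠ 0} := by
    have hpos : ∀ x : ℝ × ℝ, x ≠ 0 → Real.sqrt (x.1 ^ 2 + x.2 ^ 2) ≠ 0 := by
      intro x hx h
      rw [Real.sqrt_eq_zero (by positivity)] at h
      apply hx
      exact Prod.ext (by simp; nlinarith [sq_nonneg x.1, sq_nonneg x.2])
        (by simp; nlinarith [sq_nonneg x.1, sq_nonneg x.2])
    refine ContinuousOn.mul (ContinuousOn.mul continuousOn_const ?_) ?_
    · refine Complex.continuous_ofReal.comp_continuousOn ?_
      refine ContinuousOn.rpow_const (by fun_prop) fun x hx => Or.inl (hpos x hx)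
    · refine ContinuousOn.zpow₀ (ContinuousOn.div (by fun_prop) (by fun_prop) ?_) _ ?_
      · intro x hx
        exact_mod_cast hpos x hx
      · intro x hx
        left
        refine div_ne_zero ?_ (Complex.ofReal_ne_zero.mpr (hpos x hx))
        intro h
        apply hx
        have ha := congrArg Complex.re h
        have hb := congrArg Complex.im h
        simp at ha hb
        exact Prod.ext ha hb
  refine hcont.congr fun x hx => ?_
  obtain ⟨r, hr, t, ht, rfl⟩ := key x hx
  have hsq : Real.sqrt ((r * Real.cos t) ^ 2 + (r * Real.sin t) ^ 2) = r := by
    rw [show (r * Real.cos t) ^ 2 + (r * Real.sin t) ^ 2 = r ^ 2 by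
      linear_combination r ^ 2 * Real.sin_sq_add_cos_sq t]
    exact Real.sqrt_sq hr.le
  have hr' : (r : ℂ) ≠ 0 := by exact_mod_cast hr.ne'
  have hq : (((r * Real.cos t : ℝ) : ℂ) + ((r * Real.sin t : ℝ) : ℂ) * Complex.I) / (r : ℂ)
      = Complex.exp (t * Complex.I) := by
    rw [Complex.exp_mul_I]
    push_cast
    field_simp
  have hh := h2 r hr t ht
  simp only [hsq, hq]
  rw [← Complex.exp_int_mul]
  rw [hh]
  congr 2
  push_cast
  ring
end
end

section
/- Let k ≥ 1 and let α¹,…,αᵏ ∈ (−π,π] be pairwise distinct modulo π. Set Σ^j := {s(cos αʲ, sin αʲ) : s ∈ ℝ} and L := Σ¹ ∪ ⋯ ∪ Σᵏ. Let φ, ψ be real-valued functions defined on the closed unit disk minus L such that, on each connected component S of D₁∖L, φ and ψ coincide with the restrictions of functions of class C¹ on the closure of S. Then ∫_{D₁} (φ(x)² + ψ(x)²) dx ≤ ∫_{∂D₁} (φ² + ψ²) dH¹ + ∫_{D₁∖L} (|∇φ(x)|² + |∇ψ(x)|²) dx, where D₁ is the open unit disk, ∂D₁ the unit circle, and H¹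 the 1-dimensional Hausdorff measure (the finitely many points of ∂D₁ ∩ L being H¹-negligible). No relation between the values of φ, ψ on the two sides of any line Σ^j is required. -/
/- STATEMENT 10: the divergence-theorem inequality
   ∫_{D₁}(φ²+ψ²) ≤ ∫_{∂D₁}(φ²+ψ²) dH¹ + ∫_{D₁∖L}(|∇φ|²+|∇ψ|²),
   for functions that are piecewise C¹ up to the boundary on the sectors of the unit disk
   cut out by finitely many lines L through the origin with pairwise distinct directions
   modulo π; no transmission relation across the lines is required. -/

noncomputable section

open Real Set MeasureTheory ENNReal

abbrev E2 := EuclideanSpace ℝ (Fin 2)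

def pt2 (a b : ℝ) : E2 := (WithLp.equiv 2 (Fin 2 → ℝ)).symm ![a, b]

/-- The unit vector at angle `t`. -/
def ev (t : ℝ) : E2 := pt2 (Real.cos t) (Real.sin t)

theorem ev_continuous : Continuous ev := by
  unfold ev pt2
  have : Continuous (fun t : ℝ => (![Real.cos t, Real.sin t] : Fin 2 → ℝ)) := by
    refine continuous_pi fun i => ?_
    fin_cases i
    · exact Real.continuous_cos
    · exact Real.continuous_sin
  exact (PiLp.continuous_toLp 2 _).comp this

theorem ev_norm (t : ℝ) : ‖ev t‖ = 1 := by
  rw [EuclideanSpace.norm_eq]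
  simp [ev, pt2, Fin.sum_univ_two]

theorem ev_dist (a b : ℝ) : dist (ev a) (ev b) = 2 * |Real.sin ((a - b) / 2)| := by
  rw [EuclideanSpace.dist_eq]
  have h2 : (2 * |Real.sin ((a - b) / 2)|) = √((2 * |Real.sin ((a - b) / 2)|) ^ 2) :=
    (Real.sqrt_sq (by positivity)).symm
  rw [h2]
  congr 1
  rw [mul_pow, sq_abs, Real.sin_sq_eq_half_sub]
  have : 2 * ((a - b) / 2) = a - b := by ring
  rw [this, Real.cos_sub]
  simp only [ev, pt2, Fin.sum_univ_two, Real.dist_eq, sq_abs]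
  simp
  nlinarith [Real.sin_sq_add_cos_sq a, Real.sin_sq_add_cos_sq b]

theorem chord_bound (η x : ℝ) (h0 : 0 < η) (h1 : η < 1) (hx : |x| ≤ 2 * (π - η))
    (hs : 2 * |Real.sin (x / 2)| ≤ η) : (1 - η ^ 2) * |x| ≤ 2 * |Real.sin (x / 2)| := by
  wlog hx0 : 0 ≤ x generalizing x
  · have := this (-x) (by rwa [abs_neg]) (by rwa [neg_div, Real.sin_neg, abs_neg]) (by linarith)
    rwa [neg_div, Real.sin_neg, abs_neg, abs_neg] at this
  rw [abs_of_nonneg hx0] at hx ⊢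
  have hpi := Real.pi_gt_three
  have hpi4 := Real.pi_lt_d2
  have hsn : 0 ≤ Real.sin (x / 2) := Real.sin_nonneg_of_nonneg_of_le_pi (by linarith) (by linarith)
  rw [abs_of_nonneg hsn] at hs ⊢
  have key : x / 2 ≤ π / 2 * Real.sin (x / 2) := by
    rcases le_total (x / 2) (π / 2) with h | h
    · have := Real.mul_le_sin (x := x / 2) (by linarith) h
      rw [div_mul_eq_mul_div, div_le_iff₀ Real.pi_pos] at this
      linarith
    · exfalso
      have := Real.mul_le_sin (x := π - x / 2) (by linarith) (by linarith)
      rw [Real.sin_pi_sub, div_mul_eq_mul_div, div_le_iff₀ Real.pi_pos] at this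
      nlinarith [mul_le_mul_of_nonneg_right hs Real.pi_pos.le, mul_lt_mul_of_pos_left hpi4 h0]
  have hxη : x ≤ 2 * η := by nlinarith
  have h3 := (abs_le.mp (Real.abs_sub_sin_le (x / 2))).2
  rw [abs_of_nonneg (by linarith : (0:ℝ) ≤ x / 2)] at h3
  have : x ^ 3 ≤ (2 * η) ^ 2 * x := by
    have : x ^ 2 ≤ (2 * η) ^ 2 := by gcongr
    nlinarith
  nlinarith [mul_nonneg hx0 (sq_nonneg η)]

theorem map_eta_le (η : ℝ) (h0 : 0 < η) (h1 : η < 1) :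
    ENNReal.ofReal (1 - η ^ 2) • (volume.restrict (Ioo (-π + η) (π - η))).map ev
      ≤ (MeasureTheory.Measure.hausdorffMeasure 1 : Measure E2) := by
  have hc : 0 < 1 - η ^ 2 := by nlinarith
  refine Measure.le_hausdorffMeasure 1 _ (ENNReal.ofReal η) (by simpa using h0) ?_
  intro s hs
  rw [ENNReal.rpow_one]
  have hcl : MeasurableSet (closure s) := isClosed_closure.measurableSet
  calc _ ≤ (ENNReal.ofReal (1 - η ^ 2) • (volume.restrict (Ioo (-π + η) (π - η))).map ev)
        (closure s) := measure_mono subset_closure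
    _ = ENNReal.ofReal (1 - η ^ 2) * volume (ev ⁻¹' closure s ∩ Ioo (-π + η) (π - η)) := by
        rw [Measure.smul_apply, Measure.map_apply ev_continuous.measurable hcl,
          Measure.restrict_apply (ev_continuous.measurable hcl), smul_eq_mul]
    _ ≤ ENNReal.ofReal (1 - η ^ 2) *
          Metric.ediam (ev ⁻¹' closure s ∩ Ioo (-π + η) (π - η)) := by
        gcongr
        exact Real.volume_le_diam _
    _ ≤ Metric.ediam s := by
        rw [mul_comm, ← ENNReal.le_div_iff_mul_le (by left; simpa using hc) (by left; simp)]
        refine Metric.ediam_le ?_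
        rintro a ⟨ha, ha'⟩ b ⟨hb, hb'⟩
        rw [ENNReal.le_div_iff_mul_le (by left; simpa using hc) (by left; simp)]
        have hd : edist (ev a) (ev b) ≤ Metric.ediam s := by
          rw [← Metric.ediam_closure s]
          exact Metric.edist_le_ediam_of_mem ha hb
        refine le_trans ?_ hd
        have h2 := hd.trans hs
        rw [edist_dist, ENNReal.ofReal_le_ofReal_iff h0.le, ev_dist] at h2
        rw [edist_dist, edist_dist, ← ENNReal.ofReal_mul dist_nonneg, ev_dist, Real.dist_eq]
        apply ENNReal.ofReal_le_ofReal
        rw [mul_comm]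
        refine chord_bound η _ h0 h1 ?_ h2
        rw [abs_le]
        constructor <;> linarith [ha'.1, ha'.2, hb'.1, hb'.2]

theorem map_ev_le :
    (volume.restrict (Ioo (-π) π)).map ev
      ≤ (MeasureTheory.Measure.hausdorffMeasure 1 : Measure E2) := by
  refine Measure.le_iff.mpr fun A hA => ?_
  rw [Measure.map_apply ev_continuous.measurable hA,
          Measure.restrict_apply (ev_continuous.measurable hA)]
  by_cases hy : (MeasureTheory.Measure.hausdorffMeasure 1 : Measure E2) A = ∞
  · rw [hy]; exact le_top
  set P := ev ⁻¹' A with hP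
  have hPm : MeasurableSet P := ev_continuous.measurable hA
  have hfin : volume (P ∩ Ioo (-π) π) ≠ ∞ :=
    ((measure_mono inter_subset_right).trans_lt (by simp)).ne
  rw [← ENNReal.toReal_le_toReal hfin hy]
  set x := (volume (P ∩ Ioo (-π) π)).toReal with hx
  set y := ((MeasureTheory.Measure.hausdorffMeasure 1 : Measure E2) A).toReal with hyy
  have key : ∀ η : ℝ, η ∈ Ioo (0:ℝ) 1 → (1 - η ^ 2) * (x - 2 * η) ≤ y := by
    rintro η ⟨h0, h1⟩
    have hc : 0 < 1 - η ^ 2 := by nlinarith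
    have h := map_eta_le η h0 h1 A
    rw [Measure.smul_apply, Measure.map_apply ev_continuous.measurable hA,
          Measure.restrict_apply (ev_continuous.measurable hA), smul_eq_mul] at h
    have hfin' : volume (P ∩ Ioo (-π + η) (π - η)) ≠ ∞ :=
      ((measure_mono inter_subset_right).trans_lt (by simp)).ne
    have h' := ENNReal.toReal_mono hy h
    rw [ENNReal.toReal_mul, ENNReal.toReal_ofReal hc.le] at h'
    have hsub : P ∩ Ioo (-π) π ⊆ P ∩ Ioo (-π + η) (π - η) ∪
        (Icc (-π) (-π + η) ∪ Icc (π - η) π) := by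
      rintro t ⟨ht, ht1, ht2⟩
      by_cases h3 : t ≤ -π + η
      · right; left; exact ⟨ht1.le, h3⟩
      by_cases h4 : π - η ≤ t
      · right; right; exact ⟨h4, ht2.le⟩
      left; exact ⟨ht, not_le.mp h3, not_le.mp h4⟩
    have h5 : volume (P ∩ Ioo (-π) π) ≤ volume (P ∩ Ioo (-π + η) (π - η)) +
        (ENNReal.ofReal η + ENNReal.ofReal η) := by
      refine (measure_mono hsub).trans ((measure_union_le _ _).trans ?_)
      gcongr
      refine (measure_union_le _ _).trans ?_
      rw [Real.volume_Icc, Real.volume_Icc]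
      simp
    have h6 := ENNReal.toReal_mono (by finiteness) h5
    rw [ENNReal.toReal_add hfin' (by finiteness), ENNReal.toReal_add (by finiteness) (by finiteness),
      ENNReal.toReal_ofReal h0.le] at h6
    refine le_trans ?_ h'
    gcongr
    linarith
  have hlim : Filter.Tendsto (fun η : ℝ => (1 - η ^ 2) * (x - 2 * η)) (nhdsWithin 0 (Ioi 0))
      (nhds x) := by
    have : ContinuousAt (fun η : ℝ => (1 - η ^ 2) * (x - 2 * η)) 0 := by fun_prop
    have h := this.tendsto
    simp at h
    exact h.mono_left nhdsWithin_le_nhds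
  refine le_of_tendsto hlim ?_
  filter_upwards [Ioo_mem_nhdsGT (zero_lt_one (α := ℝ))] with η hη using key η hη

theorem lintegral_circle_le (f : E2 → ℝ≥0∞) (hf : Measurable f) :
    ∫⁻ t in Ioo (-π) π, f (ev t) ≤ ∫⁻ x in Metric.sphere (0 : E2) 1, f x
          ∂(MeasureTheory.Measure.hausdorffMeasure 1) := by
  have hs : MeasurableSet (Metric.sphere (0 : E2) 1) := Metric.isClosed_sphere.measurableSet
  rw [← lintegral_indicator hs]
  refine le_trans (le_of_eq ?_) (lintegral_mono' map_ev_le le_rfl)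
  rw [lintegral_map (hf.indicator hs) ev_continuous.measurable]
  refine lintegral_congr fun t => ?_
  rw [indicator_of_mem]
  simp [ev_norm]

theorem lintegral_polar (f : E2 → ℝ≥0∞) :
    ∫⁻ x, f x = ∫⁻ p in Ioi (0:ℝ) ×ˢ Ioo (-π) π, ENNReal.ofReal p.1 * f (p.1 • ev p.2) := by
  have h1 := (PiLp.volume_preserving_toLp (Fin 2)).lintegral_comp_emb
    (MeasurableEquiv.toLp 2 (Fin 2 → ℝ)).measurableEmbedding f
  have h2 := (volume_preserving_finTwoArrow ℝ).symm.lintegral_comp_emb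
    (MeasurableEquiv.finTwoArrow (α := ℝ)).symm.measurableEmbedding
      (fun a => f (WithLp.toLp 2 a))
  rw [← h1, ← h2, ← lintegral_comp_polarCoord_symm]
  rw [polarCoord_target]
  refine lintegral_congr fun p => ?_
  rw [smul_eq_mul]
  congr 2
  ext i
  fin_cases i <;> simp [ev, pt2, MeasurableEquiv.finTwoArrow, polarCoord_symm_apply]

theorem radial_ineq (u v u' v' A B : ℝ → ℝ) (hu : ContinuousOn u (Icc 0 1))
    (hv : ContinuousOn v (Icc 0 1))
    (hu' : ∀ r ∈ Ioo (0:ℝ) 1, HasDerivAt u (u' r) r)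
    (hv' : ∀ r ∈ Ioo (0:ℝ) 1, HasDerivAt v (v' r) r)
    (hA : ∀ r ∈ Ioo (0:ℝ) 1, |u' r| ≤ A r) (hB : ∀ r ∈ Ioo (0:ℝ) 1, |v' r| ≤ B r)
    (hAm : Measurable A) (hBm : Measurable B) :
    ∫⁻ r in Ioo (0:ℝ) 1, ENNReal.ofReal r * ENNReal.ofReal (u r ^ 2 + v r ^ 2) ≤
      ENNReal.ofReal (u 1 ^ 2 + v 1 ^ 2) +
      ∫⁻ r in Ioo (0:ℝ) 1, ENNReal.ofReal r * ENNReal.ofReal (A r ^ 2 + B r ^ 2) := by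
  have conv : ∀ w : ℝ → ℝ, ∫⁻ r in Ioo (0:ℝ) 1, ENNReal.ofReal r * ENNReal.ofReal (w r) =
      ∫⁻ r in Ioo (0:ℝ) 1, ENNReal.ofReal (r * w r) := by
    intro w
    refine setLIntegral_congr_fun measurableSet_Ioo fun r hr => ?_
    exact (ENNReal.ofReal_mul hr.1.le).symm
  rw [conv (fun r => u r ^ 2 + v r ^ 2), conv (fun r => A r ^ 2 + B r ^ 2)]
  set h : ℝ → ℝ := fun r => u r ^ 2 + v r ^ 2 with hh
  set G : ℝ → ℝ := fun r => r * (A r ^ 2 + B r ^ 2) with hG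
  by_cases htop : ∫⁻ r in Ioo (0:ℝ) 1, ENNReal.ofReal (G r) = ∞
  · change _ ≤ _ + ∫⁻ r in Ioo (0:ℝ) 1, ENNReal.ofReal (G r)
    rw [htop]; simp
  have hGm : Measurable G := by fun_prop
  have hGnn : ∀ r ∈ Ioo (0:ℝ) 1, 0 ≤ G r := fun r hr => by
    have := hr.1; simp only [hG]; positivity
  have hGint : IntegrableOn G (Ioo 0 1) := by
    refine ⟨hGm.aestronglyMeasurable, ?_⟩
    rw [hasFiniteIntegral_iff_ofReal]
    · exact lt_top_iff_ne_top.mpr htop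
    · exact (ae_restrict_iff' measurableSet_Ioo).mpr (Filter.Eventually.of_forall hGnn)
  have hGI : IntegrableOn G (Icc 0 1) := by
    rwa [integrableOn_Icc_iff_integrableOn_Ioo]
  have hhc : ContinuousOn h (Icc 0 1) := (hu.pow 2).add (hv.pow 2)
  have hgc : ContinuousOn (fun r => r * h r) (Icc 0 1) := continuousOn_id.mul hhc
  have hgI : IntegrableOn (fun r => r * h r) (Icc 0 1) := hgc.integrableOn_Icc
  have hprim : ContinuousOn (fun r => ∫ t in (0:ℝ)..r, t * h t) (Icc 0 1) := by
    have := intervalIntegral.continuousOn_primitive_interval (f := fun r => r * h r)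
      (μ := volume) (a := 0) (b := 1) (by rwa [uIcc_of_le zero_le_one])
    rwa [uIcc_of_le zero_le_one] at this
  have main := intervalIntegral.sub_le_integral_of_hasDeriv_right_of_le
    (g := fun r => (∫ t in (0:ℝ)..r, t * h t) - r ^ 2 * h r)
    (g' := fun r => r * h r - (2 * r * h r + r ^ 2 * (2 * u r * u' r + 2 * v r * v' r)))
    (φ := G) (a := 0) (b := 1) zero_le_one
    (hprim.sub ((continuousOn_id.pow 2).mul hhc)) ?_ hGI ?_
  · rw [intervalIntegral.integral_same] at main
    simp only [one_pow, one_mul] at main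
    have e1 : ∫⁻ r in Ioo (0:ℝ) 1, ENNReal.ofReal (r * h r) =
        ENNReal.ofReal (∫ t in (0:ℝ)..1, t * h t) := by
      rw [intervalIntegral.integral_of_le zero_le_one, integral_Ioc_eq_integral_Ioo,
        ofReal_integral_eq_lintegral_ofReal]
      · exact hgI.mono_set Ioo_subset_Icc_self
      · refine (ae_restrict_iff' measurableSet_Ioo).mpr (Filter.Eventually.of_forall ?_)
        intro r hr
        have := hr.1; simp only [hh, Pi.zero_apply]; positivity
    have e2 : ∫⁻ r in Ioo (0:ℝ) 1, ENNReal.ofReal (G r) =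
        ENNReal.ofReal (∫ t in (0:ℝ)..1, G t) := by
      rw [intervalIntegral.integral_of_le zero_le_one, integral_Ioc_eq_integral_Ioo,
        ofReal_integral_eq_lintegral_ofReal hGint]
      exact (ae_restrict_iff' measurableSet_Ioo).mpr (Filter.Eventually.of_forall hGnn)
    change ∫⁻ r in Ioo (0:ℝ) 1, ENNReal.ofReal (r * h r) ≤ ENNReal.ofReal (h 1) +
      ∫⁻ r in Ioo (0:ℝ) 1, ENNReal.ofReal (G r)
    rw [e1, e2]
    refine le_trans (ENNReal.ofReal_le_ofReal ?_) ENNReal.ofReal_add_le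
    simp at main
    linarith
  · intro r hr
    have hmem : Icc (0:ℝ) 1 ∈ nhds r := Icc_mem_nhds hr.1 hr.2
    have d1 : HasDerivAt (fun r => ∫ t in (0:ℝ)..r, t * h t) (r * h r) r := by
      refine intervalIntegral.integral_hasDerivAt_right ?_ ?_ (hgc.continuousAt hmem)
      · rw [intervalIntegrable_iff_integrableOn_Icc_of_le hr.1.le]
        exact hgI.mono_set (Icc_subset_Icc_right hr.2.le)
      · exact ContinuousOn.stronglyMeasurableAtFilter_nhdsWithin (s := Icc 0 1) hgc
          measurableSet_Icc r |>.filter_mono (by rw [nhdsWithin_eq_nhds.mpr hmem])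
    have d2 : HasDerivAt (fun r => r ^ 2 * h r)
        (2 * r * h r + r ^ 2 * (2 * u r * u' r + 2 * v r * v' r)) r := by
      have := (hasDerivAt_pow 2 r).mul (((hu' r hr).pow 2).add ((hv' r hr).pow 2))
      convert! this using 1
      simp [hh]
    exact (d1.sub d2).hasDerivWithinAt
  · intro r hr
    have h0 := hr.1
    have h1 := hr.2
    have a1 : (u' r) ^ 2 ≤ A r ^ 2 := sq_le_sq.mpr ((hA r hr).trans (le_abs_self _))
    have b1 : (v' r) ^ 2 ≤ B r ^ 2 := sq_le_sq.mpr ((hB r hr).trans (le_abs_self _))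
    have key : -(r * h r) - r ^ 2 * (2 * u r * u' r + 2 * v r * v' r) ≤
        r * ((u' r) ^ 2 + (v' r) ^ 2) := by
      have e : r * ((u' r) ^ 2 + (v' r) ^ 2) -
          (-(r * h r) - r ^ 2 * (2 * u r * u' r + 2 * v r * v' r)) =
          r * ((u r + r * u' r) ^ 2 + (v r + r * v' r) ^ 2 +
            (1 - r ^ 2) * ((u' r) ^ 2 + (v' r) ^ 2)) := by
        simp only [hh]; ring
      have : 0 ≤ 1 - r ^ 2 := by nlinarith
      have : 0 ≤ r * ((u r + r * u' r) ^ 2 + (v r + r * v' r) ^ 2 +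
            (1 - r ^ 2) * ((u' r) ^ 2 + (v' r) ^ 2)) := by positivity
      linarith
    have k2 : r * ((u' r) ^ 2 + (v' r) ^ 2) ≤ G r := by
      simp only [hG]; gcongr
    linarith

/-- The regularity hypothesis of the main theorem for one function. -/
def PwReg (L : Set E2) (φ : E2 → ℝ) : Prop :=
  ∀ x ∈ Metric.ball (0 : E2) 1 \ L, ∃ F : E2 → ℝ,
    ContDiffOn ℝ 1 F (closure (connectedComponentIn (Metric.ball (0 : E2) 1 \ L) x)) ∧
    Set.EqOn φ F (closure (connectedComponentIn (Metric.ball (0 : E2) 1 \ L) x) \ L)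

theorem PwReg.differentiableAt {L : Set E2} (hLc : IsClosed L) {φ : E2 → ℝ} (h : PwReg L φ)
    {x : E2} (hx : x ∈ Metric.ball (0 : E2) 1 \ L) : DifferentiableAt ℝ φ x := by
  obtain ⟨F, hF, hE⟩ := h x hx
  have hU : IsOpen (Metric.ball (0 : E2) 1 \ L) := Metric.isOpen_ball.sdiff hLc
  have hS : connectedComponentIn (Metric.ball (0 : E2) 1 \ L) x ∈ nhds x :=
    hU.connectedComponentIn.mem_nhds (mem_connectedComponentIn hx)
  have hd : DifferentiableAt ℝ F x :=
    (hF.contDiffAt (Filter.mem_of_superset hS subset_closure)).differentiableAt (by simp)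
  refine hd.congr_of_eventuallyEq ?_
  filter_upwards [hS] with y hy
  exact hE ⟨subset_closure hy, (connectedComponentIn_subset _ _ hy).2⟩

theorem PwReg.ray {L : Set E2} (hLc : IsClosed L)
    (hcone : ∀ (r : ℝ) (p : E2), 0 < r → r • p ∈ L → p ∈ L) {φ : E2 → ℝ} (h : PwReg L φ)
    {p : E2} (hp : ‖p‖ = 1) (hpL : p ∉ L) :
    (∀ r ∈ Ioo (0:ℝ) 1, r • p ∈ Metric.ball (0 : E2) 1 \ L) ∧
    ∃ u : ℝ → ℝ, ContinuousOn u (Icc 0 1) ∧ (∀ r ∈ Ioc (0:ℝ) 1, u r = φ (r • p)) ∧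
      ∀ r ∈ Ioo (0:ℝ) 1, HasDerivAt u (fderiv ℝ φ (r • p) p) r := by
  have hmem : ∀ r ∈ Ioo (0:ℝ) 1, r • p ∈ Metric.ball (0 : E2) 1 \ L := by
    rintro r ⟨h0, h1⟩
    refine ⟨?_, fun hr => hpL (hcone r p h0 hr)⟩
    rw [mem_ball_zero_iff, norm_smul, hp, mul_one, Real.norm_of_nonneg h0.le]
    exact h1
  refine ⟨hmem, ?_⟩
  have hhalf : (1/2 : ℝ) ∈ Ioo (0:ℝ) 1 := by norm_num
  obtain ⟨F, hF, hE⟩ := h ((1/2 : ℝ) • p) (hmem _ hhalf)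
  set S := connectedComponentIn (Metric.ball (0 : E2) 1 \ L) ((1/2 : ℝ) • p) with hSdef
  have hcont : Continuous (fun r : ℝ => r • p) := by fun_prop
  have hsub : (fun r : ℝ => r • p) '' Ioo (0:ℝ) 1 ⊆ S := by
    refine IsPreconnected.subset_connectedComponentIn
      (isPreconnected_Ioo.image _ hcont.continuousOn) ⟨_, hhalf, rfl⟩ ?_
    rintro _ ⟨r, hr, rfl⟩
    exact hmem r hr
  have hcl : ∀ r ∈ Icc (0:ℝ) 1, r • p ∈ closure S := by
    intro r hr
    rw [← closure_Ioo (zero_ne_one (α := ℝ))] at hr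
    exact closure_mono hsub (image_closure_subset_closure_image hcont ⟨r, hr, rfl⟩)
  have heq : ∀ r ∈ Ioc (0:ℝ) 1, F (r • p) = φ (r • p) := by
    intro r hr
    exact (hE ⟨hcl r ⟨hr.1.le, hr.2⟩, fun hr' => hpL (hcone r p hr.1 hr')⟩).symm
  refine ⟨fun r => F (r • p), ?_, heq, ?_⟩
  · exact hF.continuousOn.comp hcont.continuousOn hcl
  · intro r hr
    have hd := (h.differentiableAt hLc (hmem r hr)).hasFDerivAt
    have hl : HasDerivAt (fun r : ℝ => r • p) p r := by
      simpa using (hasDerivAt_id r).smul_const p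
    refine (hd.comp_hasDerivAt r hl).congr_of_eventuallyEq ?_
    filter_upwards [Ioo_mem_nhds hr.1 hr.2] with s hs
    exact heq s ⟨hs.1, hs.2.le⟩

theorem main_ineq (L : Set E2) (hLc : IsClosed L)
    (hcone : ∀ (r : ℝ) (p : E2), 0 < r → r • p ∈ L → p ∈ L)
    (hae : ∀ᵐ t : ℝ, ev t ∉ L) (φ ψ : E2 → ℝ) (hφ : PwReg L φ) (hψ : PwReg L ψ) :
    ∫⁻ x in Metric.ball (0 : E2) 1, ENNReal.ofReal (φ x ^ 2 + ψ x ^ 2) ≤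
      (∫⁻ x in Metric.sphere (0 : E2) 1, ENNReal.ofReal (φ x ^ 2 + ψ x ^ 2)
          ∂(MeasureTheory.Measure.hausdorffMeasure 1)) +
        ∫⁻ x in Metric.ball (0 : E2) 1 \ L,
          ENNReal.ofReal (‖fderiv ℝ φ x‖ ^ 2 + ‖fderiv ℝ ψ x‖ ^ 2) := by
  classical
  set U := Metric.ball (0 : E2) 1 \ L with hUdef
  have hU : IsOpen U := Metric.isOpen_ball.sdiff hLc
  set f : E2 → ℝ≥0∞ := fun x => ENNReal.ofReal (φ x ^ 2 + ψ x ^ 2) with hf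
  set g : E2 → ℝ≥0∞ := fun x => ENNReal.ofReal (‖fderiv ℝ φ x‖ ^ 2 + ‖fderiv ℝ ψ x‖ ^ 2) with hg
  have hgm : Measurable g := by
    have h1 := measurable_fderiv ℝ φ
    have h2 := measurable_fderiv ℝ ψ
    exact ((h1.norm.pow_const 2).add (h2.norm.pow_const 2)).ennreal_ofReal
  -- boundary values as limits from inside
  have hfUm : Measurable (U.indicator f) := by
    have hφc : ContinuousOn φ U := fun x hx =>
      (hφ.differentiableAt hLc hx).continuousAt.continuousWithinAt
    have hψc : ContinuousOn ψ U := fun x hx =>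
      (hψ.differentiableAt hLc hx).continuousAt.continuousWithinAt
    have hfc : ContinuousOn f U :=
      ENNReal.continuous_ofReal.comp_continuousOn ((hφc.pow 2).add (hψc.pow 2))
    rw [← piecewise_eq_indicator]
    exact hfc.measurable_piecewise continuousOn_const hU.measurableSet
  set f' : E2 → ℝ≥0∞ := fun x =>
    Filter.limsup (fun n : ℕ => U.indicator f ((1 - 1 / ((n : ℝ) + 2)) • x)) Filter.atTop with hf'
  have hf'm : Measurable f' := by
    refine Measurable.limsup fun n => ?_
    exact hfUm.comp (measurable_const_smul _)
  have hff' : ∀ p : E2, ‖p‖ = 1 → p ∉ L → f' p = f p := by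
    intro p hp hpL
    obtain ⟨hmem, u, huc, hu, -⟩ := hφ.ray hLc hcone hp hpL
    obtain ⟨-, v, hvc, hv, -⟩ := hψ.ray hLc hcone hp hpL
    have hrn : ∀ n : ℕ, (1 - 1 / ((n : ℝ) + 2)) ∈ Ioo (0:ℝ) 1 := by
      intro n
      have hn : (0:ℝ) ≤ n := n.cast_nonneg
      have : 1 / ((n : ℝ) + 2) ≤ 1 / 2 := by gcongr; linarith
      have : 0 < 1 / ((n : ℝ) + 2) := by positivity
      constructor <;> linarith
    have hfp : f p = ENNReal.ofReal (u 1 ^ 2 + v 1 ^ 2) := by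
      rw [hu 1 (by simp), hv 1 (by simp), one_smul]
    apply Filter.Tendsto.limsup_eq
    have hlim : Filter.Tendsto (fun n : ℕ => (1 - 1 / ((n : ℝ) + 2))) Filter.atTop
        (nhdsWithin 1 (Icc 0 1)) := by
      refine tendsto_nhdsWithin_iff.mpr ⟨?_, Filter.Eventually.of_forall
        fun n => Ioo_subset_Icc_self (hrn n)⟩
      have h1 : Filter.Tendsto (fun n : ℕ => 1 / ((n : ℝ) + 2)) Filter.atTop (nhds 0) := by
        simp only [one_div]
        exact tendsto_inv_atTop_zero.comp
          (Filter.tendsto_atTop_add_const_right _ _ tendsto_natCast_atTop_atTop)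
      simpa using h1.const_sub 1
    have hcw : ContinuousWithinAt (fun r => ENNReal.ofReal (u r ^ 2 + v r ^ 2)) (Icc 0 1) 1 :=
      ENNReal.continuous_ofReal.continuousAt.comp_continuousWithinAt
        (((huc.pow 2).add (hvc.pow 2)) 1 (by simp))
    rw [hfp]
    refine (hcw.tendsto.comp hlim).congr fun n => ?_
    have hm := hrn n
    rw [indicator_of_mem (hmem _ hm)]
    simp only [Function.comp, hf]
    rw [hu _ ⟨hm.1, hm.2.le⟩, hv _ ⟨hm.1, hm.2.le⟩]
  have hbdry : ∫⁻ t in Ioo (-π) π, f' (ev t) ≤ ∫⁻ x in Metric.sphere (0 : E2) 1, f x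
          ∂(MeasureTheory.Measure.hausdorffMeasure 1) := by
    calc ∫⁻ t in Ioo (-π) π, f' (ev t) = ∫⁻ t in Ioo (-π) π, (Lᶜ.indicator f') (ev t) := by
          refine lintegral_congr_ae (ae_restrict_of_ae ?_)
          filter_upwards [hae] with t ht
          rw [indicator_of_mem (by exact ht)]
      _ ≤ ∫⁻ x in Metric.sphere (0 : E2) 1, (Lᶜ.indicator f') x
          ∂(MeasureTheory.Measure.hausdorffMeasure 1) :=
        lintegral_circle_le _ (hf'm.indicator hLc.measurableSet.compl)
      _ ≤ _ := by
        refine setLIntegral_mono' Metric.isClosed_sphere.measurableSet fun x hx => ?_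
        by_cases hxL : x ∈ L
        · rw [indicator_of_notMem (by simpa using hxL)]; exact zero_le
        · rw [indicator_of_mem (by exact hxL), hff' x (by simpa using hx) hxL]
  -- the radial inequality
  have hrad : ∀ t : ℝ, ev t ∉ L →
      ∫⁻ r in Ioi (0:ℝ), ENNReal.ofReal r * (Metric.ball (0 : E2) 1).indicator f (r • ev t) ≤
      f' (ev t) + ∫⁻ r in Ioi (0:ℝ), ENNReal.ofReal r * U.indicator g (r • ev t) := by
    intro t ht
    have hp := ev_norm t
    obtain ⟨hmem, u, huc, hu, hu'⟩ := hφ.ray hLc hcone hp ht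
    obtain ⟨-, v, hvc, hv, hv'⟩ := hψ.ray hLc hcone hp ht
    have hm : Measurable (fun r : ℝ => r • ev t) := by fun_prop
    have hR := radial_ineq u v _ _ (fun r => ‖fderiv ℝ φ (r • ev t)‖)
      (fun r => ‖fderiv ℝ ψ (r • ev t)‖) huc hvc hu' hv'
      (fun r _ => by simpa [hp] using (fderiv ℝ φ (r • ev t)).le_opNorm (ev t))
      (fun r _ => by simpa [hp] using (fderiv ℝ ψ (r • ev t)).le_opNorm (ev t))
      ((measurable_fderiv ℝ φ).comp hm).norm ((measurable_fderiv ℝ ψ).comp hm).norm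
    have e1 : ∫⁻ r in Ioi (0:ℝ), ENNReal.ofReal r *
        (Metric.ball (0 : E2) 1).indicator f (r • ev t) ≤
        ∫⁻ r in Ioo (0:ℝ) 1, ENNReal.ofReal r * ENNReal.ofReal (u r ^ 2 + v r ^ 2) := by
      rw [← lintegral_indicator measurableSet_Ioi, ← lintegral_indicator measurableSet_Ioo]
      refine lintegral_mono fun r => ?_
      by_cases h0 : 0 < r
      · rw [indicator_of_mem (by exact h0)]
        by_cases h1 : r < 1
        · rw [indicator_of_mem (hmem r ⟨h0, h1⟩).1,
            indicator_of_mem (s := Ioo (0:ℝ) 1) (by exact ⟨h0, h1⟩), hu r ⟨h0, h1.le⟩, hv r ⟨h0, h1.le⟩]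
        · have : r • ev t ∉ Metric.ball (0 : E2) 1 := by
            rw [mem_ball_zero_iff, norm_smul, hp, mul_one, Real.norm_of_nonneg h0.le]
            exact h1
          rw [indicator_of_notMem this, mul_zero]
          exact zero_le
      · rw [indicator_of_notMem (by exact h0)]
        exact zero_le
    have e2 : ∫⁻ r in Ioo (0:ℝ) 1, ENNReal.ofReal r * ENNReal.ofReal
          (‖fderiv ℝ φ (r • ev t)‖ ^ 2 + ‖fderiv ℝ ψ (r • ev t)‖ ^ 2) ≤
        ∫⁻ r in Ioi (0:ℝ), ENNReal.ofReal r * U.indicator g (r • ev t) := by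
      refine le_trans (le_of_eq ?_) (lintegral_mono_set (Ioo_subset_Ioi_self (a := (1:ℝ))))
      refine setLIntegral_congr_fun measurableSet_Ioo fun r hr => ?_
      rw [indicator_of_mem (hmem r hr)]
    have e3 : f' (ev t) = ENNReal.ofReal (u 1 ^ 2 + v 1 ^ 2) := by
      rw [hff' _ hp ht, hu 1 (by simp), hv 1 (by simp), one_smul]
    rw [e3]
    exact e1.trans (hR.trans (by gcongr))
  -- assembly
  have hprod : (volume.restrict (Ioi (0:ℝ) ×ˢ Ioo (-π) π) : Measure (ℝ × ℝ)) =
      (volume.restrict (Ioi (0:ℝ))).prod (volume.restrict (Ioo (-π) π)) := by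
    rw [Measure.prod_restrict]; rfl
  have hGm : Measurable (fun p : ℝ × ℝ => ENNReal.ofReal p.1 * U.indicator g (p.1 • ev p.2)) := by
    have hm : Measurable (fun p : ℝ × ℝ => p.1 • ev p.2) :=
      (continuous_fst.smul (ev_continuous.comp continuous_snd)).measurable
    exact measurable_fst.ennreal_ofReal.mul ((hgm.indicator hU.measurableSet).comp hm)
  rw [← lintegral_indicator measurableSet_ball f, lintegral_polar, hprod, ← lintegral_prod_swap]
  refine (lintegral_prod_le _).trans ?_
  calc _ ≤ ∫⁻ t in Ioo (-π) π, (f' (ev t) +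
        ∫⁻ r in Ioi (0:ℝ), ENNReal.ofReal r * U.indicator g (r • ev t)) := by
        refine lintegral_mono_ae (ae_restrict_of_ae ?_)
        filter_upwards [hae] with t ht
        exact hrad t ht
    _ = (∫⁻ t in Ioo (-π) π, f' (ev t)) + ∫⁻ t in Ioo (-π) π,
        ∫⁻ r in Ioi (0:ℝ), ENNReal.ofReal r * U.indicator g (r • ev t) :=
        lintegral_add_left (hf'm.comp ev_continuous.measurable) _
    _ ≤ _ := by
        gcongr
        rw [← lintegral_indicator hU.measurableSet, lintegral_polar, hprod,
          lintegral_prod_symm' _ hGm]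

theorem divergence_inequality_disk
    (k : ℕ) (hk : 1 ≤ k) (α : Fin k → ℝ)
    (hmem : ∀ j, α j ∈ Set.Ioc (-Real.pi) Real.pi)
    (hdist : ∀ i j : Fin k, i ≠ j →
      α i ≠ α j ∧ α i ≠ α j + Real.pi ∧ α i ≠ α j - Real.pi)
    (L : Set E2)
    (hL : L = ⋃ j, {x : E2 | ∃ s : ℝ, x = s • pt2 (Real.cos (α j)) (Real.sin (α j))})
    (φ ψ : E2 → ℝ)
    (hreg : ∀ x ∈ Metric.ball (0 : E2) 1 \ L,
      ∃ F G : E2 → ℝ,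
        ContDiffOn ℝ 1 F (closure (connectedComponentIn (Metric.ball (0 : E2) 1 \ L) x)) ∧
        ContDiffOn ℝ 1 G (closure (connectedComponentIn (Metric.ball (0 : E2) 1 \ L) x)) ∧
        Set.EqOn φ F (closure (connectedComponentIn (Metric.ball (0 : E2) 1 \ L) x) \ L) ∧
        Set.EqOn ψ G (closure (connectedComponentIn (Metric.ball (0 : E2) 1 \ L) x) \ L)) :
    ∫⁻ x in Metric.ball (0 : E2) 1, ENNReal.ofReal (φ x ^ 2 + ψ x ^ 2) ≤
      (∫⁻ x in Metric.sphere (0 : E2) 1, ENNReal.ofReal (φ x ^ 2 + ψ x ^ 2)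
          ∂(MeasureTheory.Measure.hausdorffMeasure 1)) +
        ∫⁻ x in Metric.ball (0 : E2) 1 \ L,
          ENNReal.ofReal (‖fderiv ℝ φ x‖ ^ 2 + ‖fderiv ℝ ψ x‖ ^ 2) := by
  have hL' : L = ⋃ j, ((ℝ ∙ ev (α j) : Submodule ℝ E2) : Set E2) := by
    rw [hL]
    ext x
    simp only [mem_iUnion, mem_setOf_eq, SetLike.mem_coe, Submodule.mem_span_singleton]
    exact exists_congr fun j => exists_congr fun s => eq_comm
  have hLc : IsClosed L := by
    rw [hL']
    exact isClosed_iUnion_of_finite fun j => Submodule.closed_of_finiteDimensional _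
  have hcone : ∀ (r : ℝ) (p : E2), 0 < r → r • p ∈ L → p ∈ L := by
    intro r p hr hp
    rw [hL'] at hp ⊢
    simp only [mem_iUnion, SetLike.mem_coe] at hp ⊢
    obtain ⟨j, hj⟩ := hp
    exact ⟨j, (Submodule.smul_mem_iff _ hr.ne').mp hj⟩
  have hae : ∀ᵐ t : ℝ, ev t ∉ L := by
    have hc : (⋃ j, range (fun n : ℤ => α j + n * Real.pi)).Countable :=
      countable_iUnion fun j => countable_range _
    filter_upwards [hc.ae_notMem volume] with t ht hmemL
    apply ht
    rw [hL] at hmemL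
    simp only [mem_iUnion, mem_setOf_eq] at hmemL
    obtain ⟨j, s, hs⟩ := hmemL
    have h0 : Real.cos t = s * Real.cos (α j) := by
      have := congrArg (fun x : E2 => x 0) hs
      simpa [ev, pt2] using this
    have h1 : Real.sin t = s * Real.sin (α j) := by
      have := congrArg (fun x : E2 => x 1) hs
      simpa [ev, pt2] using this
    have h2 : Real.sin (t - α j) = 0 := by
      rw [Real.sin_sub, h0, h1]; ring
    obtain ⟨n, hn⟩ := Real.sin_eq_zero_iff.mp h2
    exact mem_iUnion.mpr ⟨j, n, by simp only; linarith⟩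
  refine main_ineq L hLc hcone hae φ ψ ?_ ?_
  · intro x hx
    obtain ⟨F, G, h1, h2, h3, h4⟩ := hreg x hx
    exact ⟨F, h1, h3⟩
  · intro x hx
    obtain ⟨F, G, h1, h2, h3, h4⟩ := hreg x hx
    exact ⟨G, h2, h4⟩
end
end

section
/- Fix a pole configuration with ρ := ρ¹+⋯+ρᵏ = 1/2, let m ∈ ℕ, β > 0, γ ∈ ℝ, and define Φ₀(r cos t, r sin t) := β r^{m+1/2} cos(2π f(t)) cos((m+1/2)(γ + t)) and Ψ₀(r cos t, r sin t) := β r^{m+1/2} sin(2π f(t)) cos((m+1/2)(γ + t)) for r > 0, t ∈ [0,2π). For j ∈ {1,…,k} let R_j := {s(cos αʲ, sin αʲ) : s > 0}. Then: (i) if αʲ ∈ −γ + (π/(2m+1))·(1 + 2ℤ), then Φ₀ and Ψ₀ vanish identically on R_j; (ii) if αʲ ∈ −γ + (2π/(2m+1))·ℤ, then Φ₀ and Ψ₀ are differentiable at every point of R_j with ∇Φ₀(x)·ν^j = ∇Ψ₀(x)·ν^j = 0 for all x ∈ R_j, and moreover Φ₀(x)² + Ψ₀(x)² = β²|x|^{2m+1}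 > 0 for all x ∈ R_j. -/
noncomputable section

open Real Set Filter Topology

/- STATEMENT 13: behaviour of the half-integer blow-up profiles Φ₀, Ψ₀ on the rays
   R_j = {s(cos αʲ, sin αʲ) : s > 0}:
   (i) if αʲ ∈ −γ + (π/(2m+1))(1+2ℤ) then Φ₀ and Ψ₀ vanish identically on R_j;
   (ii) if αʲ ∈ −γ + (2π/(2m+1))ℤ then Φ₀, Ψ₀ are differentiable on R_j with vanishing
   normal derivatives ∇Φ₀·ν^j = ∇Ψ₀·ν^j = 0 and Φ₀² + Ψ₀² = β²|x|^{2m+1} > 0 on R_j. -/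

theorem fStep_eventually {k : ℕ} (P : PoleConfig k) (t₀ : ℝ)
    (h : ∀ l, P.alpha l + Real.pi ≠ t₀) : ∀ᶠ t in 𝓝 t₀, fStep P t = fStep P t₀ := by
  have h1 : ∀ l, ∀ᶠ t in 𝓝 t₀, chiStep (P.alpha l) t = chiStep (P.alpha l) t₀ := by
    intro l
    rcases lt_or_gt_of_ne (h l) with hl | hl
    · filter_upwards [lt_mem_nhds hl] with t ht
      simp [chiStep, hl.le, ht.le]
    · filter_upwards [gt_mem_nhds hl] with t ht
      simp [chiStep, not_le.2 hl, not_le.2 ht]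
  filter_upwards [eventually_all.2 h1] with t ht
  simp [fStep, ht]

theorem cos_shift (m : ℕ) (x : ℝ) :
    Real.cos (((m : ℝ) + 1 / 2) * (x + 2 * Real.pi)) = -Real.cos (((m : ℝ) + 1 / 2) * x) := by
  have : ((m : ℝ) + 1 / 2) * (x + 2 * Real.pi)
      = (((m : ℝ) + 1 / 2) * x + Real.pi) + m * (2 * Real.pi) := by ring
  rw [this, Real.cos_add_nat_mul_two_pi, Real.cos_add_pi]

theorem local_form {k : ℕ} (P : PoleConfig k) (hρ : (∑ i, P.rho i) = 1 / 2)
    (m : ℕ) (β γ : ℝ)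
    (Φ₀ Ψ₀ : ℝ × ℝ → ℝ)
    (hΦ : ∀ r : ℝ, 0 < r → ∀ t ∈ Set.Ico (0 : ℝ) (2 * Real.pi),
      Φ₀ (r * Real.cos t, r * Real.sin t) =
        β * r ^ ((m : ℝ) + 1 / 2) * Real.cos (2 * Real.pi * fStep P t) *
          Real.cos (((m : ℝ) + 1 / 2) * (γ + t)))
    (hΨ : ∀ r : ℝ, 0 < r → ∀ t ∈ Set.Ico (0 : ℝ) (2 * Real.pi),
      Ψ₀ (r * Real.cos t, r * Real.sin t) =
        β * r ^ ((m : ℝ) + 1 / 2) * Real.sin (2 * Real.pi * fStep P t) *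
          Real.cos (((m : ℝ) + 1 / 2) * (γ + t)))
    (j : Fin k) :
    ∃ c : ℝ, ∀ᶠ θ in 𝓝 (P.alpha j), ∀ r : ℝ, 0 < r →
      Φ₀ (r * Real.cos θ, r * Real.sin θ) = β * Real.cos c * r ^ ((m : ℝ) + 1 / 2) *
          Real.cos (((m : ℝ) + 1 / 2) * (γ + θ)) ∧
      Ψ₀ (r * Real.cos θ, r * Real.sin θ) = β * Real.sin c * r ^ ((m : ℝ) + 1 / 2) *
          Real.cos (((m : ℝ) + 1 / 2) * (γ + θ)) := by
  have hpi := Real.pi_pos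
  have hmem := fun l => P.alpha_mem l
  have hshift : ∀ θ : ℝ, θ + 2 * Real.pi ∈ Set.Ico (0 : ℝ) (2 * Real.pi) → ∀ r : ℝ, 0 < r →
      Φ₀ (r * Real.cos θ, r * Real.sin θ) =
        β * Real.cos (2 * Real.pi * fStep P (θ + 2 * Real.pi) + Real.pi) *
        r ^ ((m : ℝ) + 1 / 2) * Real.cos (((m : ℝ) + 1 / 2) * (γ + θ)) ∧
      Ψ₀ (r * Real.cos θ, r * Real.sin θ) =
        β * Real.sin (2 * Real.pi * fStep P (θ + 2 * Real.pi) + Real.pi) *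
        r ^ ((m : ℝ) + 1 / 2) * Real.cos (((m : ℝ) + 1 / 2) * (γ + θ)) := by
    intro θ hθ r hr
    have e1 := hΦ r hr _ hθ
    have e2 := hΨ r hr _ hθ
    rw [Real.cos_add_two_pi, Real.sin_add_two_pi, ← add_assoc, cos_shift] at e1 e2
    rw [e1, e2, Real.cos_add_pi, Real.sin_add_pi]
    constructor <;> ring
  have hno : ∀ l, P.alpha l ≠ P.alpha j + Real.pi ∧ P.alpha l ≠ P.alpha j - Real.pi := by
    intro l
    by_cases hl : l = j
    · subst hl; constructor <;> intro h <;> linarith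
    · exact (P.alpha_distinct l j hl).2
  have hc2 : ContinuousAt (fun θ : ℝ => θ + 2 * Real.pi) (P.alpha j) := by fun_prop
  rcases lt_trichotomy (P.alpha j) 0 with hj | hj | hj
  · refine ⟨2 * Real.pi * fStep P (P.alpha j + 2 * Real.pi) + Real.pi, ?_⟩
    have hf := hc2.eventually (fStep_eventually P (P.alpha j + 2 * Real.pi)
      (fun l h => (hno l).1 (by linarith)))
    filter_upwards [hf, gt_mem_nhds hj, lt_mem_nhds (hmem j).1] with θ h1 h2 h3
    rw [← h1]
    exact hshift θ ⟨by linarith, by linarith⟩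
  · refine ⟨0, ?_⟩
    have hA := fStep_eventually P (P.alpha j)
      (fun l h => (hno l).2 (by linarith))
    have hB := hc2.eventually (fStep_eventually P (P.alpha j + 2 * Real.pi)
      (fun l h => (hno l).1 (by linarith)))
    have f0 : fStep P (P.alpha j) = 0 := by
      unfold fStep
      refine Finset.sum_eq_zero (fun l _ => ?_)
      have := (hmem l).1
      simp only [chiStep]
      rw [if_neg (by linarith), mul_zero]
    have f1 : fStep P (P.alpha j + 2 * Real.pi) = 1 / 2 := by
      rw [← hρ]
      unfold fStep
      refine Finset.sum_congr rfl (fun l _ => ?_)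
      have := (hmem l).2
      simp only [chiStep]
      rw [if_pos (by linarith), mul_one]
    have hgt : -Real.pi < P.alpha j := by linarith
    have hlt : P.alpha j < Real.pi := by linarith
    filter_upwards [hA, hB, lt_mem_nhds hgt, gt_mem_nhds hlt] with θ h1 h2 h3 h4 r hr
    rcases lt_or_ge θ 0 with h0 | h0
    · have := hshift θ ⟨by linarith, by linarith⟩ r hr
      rw [h2, f1] at this
      have e : 2 * Real.pi * (1 / 2) + Real.pi = 0 + 2 * Real.pi := by ring
      rw [e, Real.cos_add_two_pi, Real.sin_add_two_pi] at this
      exact this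
    · rw [hΦ r hr θ ⟨h0, by linarith⟩, hΨ r hr θ ⟨h0, by linarith⟩, h1, f0, mul_zero]
      constructor <;> ring
  · refine ⟨2 * Real.pi * fStep P (P.alpha j), ?_⟩
    have hA := fStep_eventually P (P.alpha j)
      (fun l h => (hno l).2 (by linarith))
    have hlt : P.alpha j < 2 * Real.pi := by linarith [(hmem j).2]
    filter_upwards [hA, lt_mem_nhds hj, gt_mem_nhds hlt] with θ h1 h2 h3 r hr
    rw [hΦ r hr θ ⟨h2.le, h3⟩, hΨ r hr θ ⟨h2.le, h3⟩, h1]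
    constructor <;> ring

/-- A function with the half-integer polar form near a ray is differentiable there, with zero
normal derivative when the angular factor is at an extremum. -/
theorem polar_diff (Φ : ℝ × ℝ → ℝ) (A p γ α : ℝ) (n : ℤ) (hn : p * (γ + α) = n * Real.pi)
    (h : ∀ᶠ θ in 𝓝 α, ∀ r : ℝ, 0 < r →
      Φ (r * Real.cos θ, r * Real.sin θ) = A * r ^ p * Real.cos (p * (γ + θ)))
    (s : ℝ) (hs : 0 < s) :
    DifferentiableAt ℝ Φ (s * Real.cos α, s * Real.sin α) ∧
    fderiv ℝ Φ (s * Real.cos α, s * Real.sin α) (-Real.sin α, Real.cos α) = 0 := by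
  set x₀ : ℝ × ℝ := (s * Real.cos α, s * Real.sin α) with hx₀
  set ν : ℝ × ℝ := (-Real.sin α, Real.cos α) with hν
  let u : ℝ × ℝ → ℝ := fun x => x.1 * Real.cos α + x.2 * Real.sin α
  let v : ℝ × ℝ → ℝ := fun x => -x.1 * Real.sin α + x.2 * Real.cos α
  let θ : ℝ × ℝ → ℝ := fun x => α + Real.arctan (v x / u x)
  let R : ℝ × ℝ → ℝ := fun x => Real.sqrt (u x ^ 2 + v x ^ 2)
  let G : ℝ × ℝ → ℝ := fun x => A * (R x) ^ p * Real.cos (p * (γ + θ x))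
  have hsc := Real.sin_sq_add_cos_sq α
  have hu : Differentiable ℝ u := by fun_prop
  have hv : Differentiable ℝ v := by fun_prop
  have hline : ∀ y : ℝ, u (x₀ + y • ν) = s ∧ v (x₀ + y • ν) = y := by
    intro y
    simp only [u, v, hx₀, hν, Prod.fst_add, Prod.snd_add, Prod.smul_fst, Prod.smul_snd, smul_eq_mul]
    constructor
    · linear_combination s * hsc
    · linear_combination y * hsc
  have hu0 : u x₀ = s := by simpa using (hline 0).1
  have hv0 : v x₀ = 0 := by simpa using (hline 0).2
  have hune : u x₀ ≠ 0 := by rw [hu0]; exact hs.ne'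
  have hqd : DifferentiableAt ℝ (fun x => v x / u x) x₀ := by
    simp only [div_eq_mul_inv]
    exact (hv x₀).mul ((hu x₀).inv hune)
  have hθd : DifferentiableAt ℝ θ x₀ := hqd.arctan.const_add α
  have hθ0 : θ x₀ = α := by simp [θ, hv0]
  have hRd : DifferentiableAt ℝ R x₀ :=
    (((hu x₀).pow 2).add ((hv x₀).pow 2)).sqrt (by
      simp only [Pi.add_apply, Pi.pow_apply, hu0, hv0]; positivity)
  have hR0 : R x₀ ≠ 0 := by
    simp only [R, hu0, hv0]; positivity
  have hGd : DifferentiableAt ℝ G x₀ :=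
    ((hRd.rpow_const (Or.inl hR0)).const_mul A).mul
      (((hθd.const_add γ).const_mul p).cos)
  have hupos : ∀ᶠ x in 𝓝 x₀, 0 < u x :=
    hu.continuous.continuousAt.eventually (lt_mem_nhds (by rw [hu0]; exact hs))
  have hθev : ∀ᶠ x in 𝓝 x₀, ∀ r : ℝ, 0 < r →
      Φ (r * Real.cos (θ x), r * Real.sin (θ x)) = A * r ^ p * Real.cos (p * (γ + θ x)) := by
    have := hθd.continuousAt
    unfold ContinuousAt at this
    rw [hθ0] at this
    exact this.eventually h
  have hEq : Φ =ᶠ[𝓝 x₀] G := by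
    filter_upwards [hupos, hθev] with x hx h1
    have hRpos : 0 < R x := Real.sqrt_pos.2 (by positivity)
    have h2 := h1 (R x) hRpos
    have hR : R x = u x * Real.sqrt (1 + (v x / u x) ^ 2) := by
      have : u x ^ 2 + v x ^ 2 = u x ^ 2 * (1 + (v x / u x) ^ 2) := by field_simp
      simp only [R]
      rw [this, Real.sqrt_mul (by positivity), Real.sqrt_sq hx.le]
    have hq : 0 < Real.sqrt (1 + (v x / u x) ^ 2) := Real.sqrt_pos.2 (by positivity)
    have hc : R x * Real.cos (Real.arctan (v x / u x)) = u x := by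
      rw [hR, Real.cos_arctan]; field_simp
    have hsn : R x * Real.sin (Real.arctan (v x / u x)) = v x := by
      rw [hR, Real.sin_arctan]; field_simp
    have e1 : R x * Real.cos (θ x) = x.1 := by
      simp only [θ]
      rw [Real.cos_add]
      have : R x * (Real.cos α * Real.cos (Real.arctan (v x / u x)) -
          Real.sin α * Real.sin (Real.arctan (v x / u x))) =
          Real.cos α * u x - Real.sin α * v x := by
        linear_combination Real.cos α * hc - Real.sin α * hsn
      rw [this]
      simp only [u, v]
      linear_combination x.1 * hsc
    have e2 : R x * Real.sin (θ x) = x.2 := by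
      simp only [θ]
      rw [Real.sin_add]
      have : R x * (Real.sin α * Real.cos (Real.arctan (v x / u x)) +
          Real.cos α * Real.sin (Real.arctan (v x / u x))) =
          Real.sin α * u x + Real.cos α * v x := by
        linear_combination Real.sin α * hc + Real.cos α * hsn
      rw [this]
      simp only [u, v]
      linear_combination x.2 * hsc
    rw [e1, e2] at h2
    exact h2
  have hΦd : DifferentiableAt ℝ Φ x₀ := hGd.congr_of_eventuallyEq hEq
  refine ⟨hΦd, ?_⟩
  rw [hEq.fderiv_eq]
  have heven : ∀ y : ℝ, G (x₀ + (-y) • ν) = G (x₀ + y • ν) := by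
    intro y
    have e : ∀ z : ℝ, p * (γ + (α + z)) = p * z + n * Real.pi := by
      intro z; linear_combination hn
    simp only [G, R, θ, (hline _).1, (hline _).2, e, Real.cos_add_int_mul_pi]
    rw [neg_div, Real.arctan_neg, mul_neg, Real.cos_neg, neg_sq]
  have hF : ∀ w : ℝ × ℝ, HasDerivAt (fun y : ℝ => G (x₀ + y • w)) (fderiv ℝ G x₀ w) 0 :=
    fun w => hGd.hasFDerivAt.hasLineDerivAt w
  have h1 := hF ν
  have h2 := hF (-ν)
  have h3 : (fun y : ℝ => G (x₀ + y • (-ν))) = fun y : ℝ => G (x₀ + y • ν) := by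
    funext y
    rw [smul_neg, ← neg_smul, heven]
  rw [h3, map_neg] at h2
  have := h1.unique h2
  linarith

theorem half_integer_profile_on_rays
    (k : ℕ) (P : PoleConfig k) (hρ : (∑ i, P.rho i) = 1 / 2)
    (m : ℕ) (β γ : ℝ) (hβ : 0 < β)
    (Φ₀ Ψ₀ : ℝ × ℝ → ℝ)
    (hΦ : ∀ r : ℝ, 0 < r → ∀ t ∈ Set.Ico (0 : ℝ) (2 * Real.pi),
      Φ₀ (r * Real.cos t, r * Real.sin t) =
        β * r ^ ((m : ℝ) + 1 / 2) * Real.cos (2 * Real.pi * fStep P t) *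
          Real.cos (((m : ℝ) + 1 / 2) * (γ + t)))
    (hΨ : ∀ r : ℝ, 0 < r → ∀ t ∈ Set.Ico (0 : ℝ) (2 * Real.pi),
      Ψ₀ (r * Real.cos t, r * Real.sin t) =
        β * r ^ ((m : ℝ) + 1 / 2) * Real.sin (2 * Real.pi * fStep P t) *
          Real.cos (((m : ℝ) + 1 / 2) * (γ + t)))
    (j : Fin k) :
    ((∃ n : ℤ, P.alpha j = -γ + Real.pi / (2 * (m : ℝ) + 1) * (1 + 2 * (n : ℝ))) →
      ∀ s : ℝ, 0 < s →
        Φ₀ (s * Real.cos (P.alpha j), s * Real.sin (P.alpha j)) = 0 ∧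
        Ψ₀ (s * Real.cos (P.alpha j), s * Real.sin (P.alpha j)) = 0) ∧
    ((∃ n : ℤ, P.alpha j = -γ + 2 * Real.pi / (2 * (m : ℝ) + 1) * (n : ℝ)) →
      ∀ s : ℝ, 0 < s →
        DifferentiableAt ℝ Φ₀ (s * Real.cos (P.alpha j), s * Real.sin (P.alpha j)) ∧
        DifferentiableAt ℝ Ψ₀ (s * Real.cos (P.alpha j), s * Real.sin (P.alpha j)) ∧
        fderiv ℝ Φ₀ (s * Real.cos (P.alpha j), s * Real.sin (P.alpha j)) (nu2 P j) = 0 ∧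
        fderiv ℝ Ψ₀ (s * Real.cos (P.alpha j), s * Real.sin (P.alpha j)) (nu2 P j) = 0 ∧
        Φ₀ (s * Real.cos (P.alpha j), s * Real.sin (P.alpha j)) ^ 2 +
            Ψ₀ (s * Real.cos (P.alpha j), s * Real.sin (P.alpha j)) ^ 2 =
          β ^ 2 * s ^ (2 * m + 1) ∧
        0 < Φ₀ (s * Real.cos (P.alpha j), s * Real.sin (P.alpha j)) ^ 2 +
            Ψ₀ (s * Real.cos (P.alpha j), s * Real.sin (P.alpha j)) ^ 2) := by
  obtain ⟨c, hc⟩ := local_form P hρ m β γ Φ₀ Ψ₀ hΦ hΨ j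
  have hm : (2 * (m : ℝ) + 1) ≠ 0 := by positivity
  have hat := hc.self_of_nhds
  refine ⟨?_, ?_⟩
  · rintro ⟨n, hn⟩ s hs
    have e : ((m : ℝ) + 1 / 2) * (γ + P.alpha j) = Real.pi / 2 + n * Real.pi := by
      rw [hn]; field_simp; ring
    have hz : Real.cos (((m : ℝ) + 1 / 2) * (γ + P.alpha j)) = 0 := by
      rw [e, Real.cos_add_int_mul_pi, Real.cos_pi_div_two, mul_zero]
    obtain ⟨h1, h2⟩ := hat s hs
    rw [h1, h2, hz]
    simp
  · rintro ⟨n, hn⟩ s hs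
    have e : ((m : ℝ) + 1 / 2) * (γ + P.alpha j) = n * Real.pi := by
      rw [hn]; field_simp; ring
    have d1 := polar_diff Φ₀ (β * Real.cos c) ((m : ℝ) + 1 / 2) γ (P.alpha j) n e
      (hc.mono fun θ h r hr => (h r hr).1) s hs
    have d2 := polar_diff Ψ₀ (β * Real.sin c) ((m : ℝ) + 1 / 2) γ (P.alpha j) n e
      (hc.mono fun θ h r hr => (h r hr).2) s hs
    have hsq : Φ₀ (s * Real.cos (P.alpha j), s * Real.sin (P.alpha j)) ^ 2 +
            Ψ₀ (s * Real.cos (P.alpha j), s * Real.sin (P.alpha j)) ^ 2 =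
          β ^ 2 * s ^ (2 * m + 1) := by
      obtain ⟨h1, h2⟩ := hat s hs
      have hp : (s ^ ((m : ℝ) + 1 / 2)) ^ 2 = s ^ (2 * m + 1) := by
        rw [← Real.rpow_natCast, ← Real.rpow_mul hs.le, ← Real.rpow_natCast]
        congr 1
        push_cast
        ring
      have hcn : Real.cos (n * Real.pi) ^ 2 = 1 := by
        have := Real.sin_sq_add_cos_sq (n * Real.pi)
        rw [Real.sin_int_mul_pi] at this
        linarith
      rw [h1, h2, e, ← hp]
      have hcc := Real.sin_sq_add_cos_sq c
      generalize s ^ ((m : ℝ) + 1 / 2) = q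
      linear_combination β ^ 2 * q ^ 2 * (Real.cos (n * Real.pi)) ^ 2 * hcc + β ^ 2 * q ^ 2 * hcn
    refine ⟨d1.1, d2.1, d1.2, d2.2, hsq, ?_⟩
    rw [hsq]
    positivity
end
end

section
/- Let ν > 0, C ≥ 0, and let Γ ⊂ ℝ² be a closed Lebesgue-null set. Let v : D₂∖Γ → ℝ be differentiable on D₂∖Γ with |v(x)| ≤ C|x|^{ν} and |∇v(x)| ≤ C|x|^{ν−1} for all x ∈ D₂∖Γ, where D_r denotes the open disk of radius r centered at 0. Let η : ℝ² → ℝ be differentiable with 0 ≤ η ≤ 1 on ℝ², η = 1 on D₁, η = 0 on ℝ²∖D₂, and |∇η| ≤ 2 on D₂∖D₁. For ε ∈ (0,1] set η_ε(x) := η(x/ε). Then there exists a constant C' > 0, depending only on C and ν, such that for every ε ∈ (0,1], ∫_{D_{2ε}∖Γ} |∇(η_ε v)(x)|² dx ≤ C'·ε^{2ν}. -/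
/- STATEMENT 14: the quantitative cutoff-energy estimate. If v vanishes at 0 with order
   ν > 0 in the C¹ sense (|v| ≤ C|x|^ν and |∇v| ≤ C|x|^{ν−1}) away from a closed null
   set Γ, and η_ε(x) = η(x/ε) is the scaled cutoff, then the Dirichlet energy of η_ε·v
   on D_{2ε}∖Γ is bounded by C'·ε^{2ν} with C' depending only on C and ν. -/

noncomputable section

open Real Set MeasureTheory ENNReal

theorem radial_integrable (ν : ℝ) (hν : 0 < ν) (r : ℝ) :
    IntegrableOn (fun x : E2 => ‖x‖ ^ (2 * ν - 2)) (Metric.ball (0 : E2) r) volume := by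
  apply integrableOn_ball_of_norm_le_rpow (C := 1) (α := 2 - 2 * ν)
  · simpa using hν
  · refine Filter.Eventually.of_forall fun x => ?_
    rw [Real.norm_of_nonneg (by positivity), one_mul]
    apply le_of_eq
    congr 1
    ring
  · exact (measurable_norm.pow_const _).aestronglyMeasurable
  · simp

open scoped Pointwise in
theorem radial_scaling (ν ε : ℝ) (hε : 0 < ε) :
    ∫ x in Metric.ball (0 : E2) (2 * ε), ‖x‖ ^ (2 * ν - 2) =
      ε ^ (2 * ν) * ∫ x in Metric.ball (0 : E2) 2, ‖x‖ ^ (2 * ν - 2) := by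
  have h := Measure.setIntegral_comp_smul_of_pos (volume : Measure E2)
    (fun x : E2 => ‖x‖ ^ (2 * ν - 2)) (Metric.ball (0 : E2) 2) hε
  have h2 : ε • Metric.ball (0 : E2) 2 = Metric.ball (0 : E2) (2 * ε) := by
    rw [smul_ball hε.ne', smul_zero, Real.norm_of_nonneg hε.le, mul_comm]
  rw [h2] at h
  have h3 : ∀ x : E2, ‖ε • x‖ ^ (2 * ν - 2) = ε ^ (2 * ν - 2) * ‖x‖ ^ (2 * ν - 2) := by
    intro x
    rw [norm_smul, Real.norm_of_nonneg hε.le, Real.mul_rpow hε.le (norm_nonneg _)]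
  simp only [h3] at h
  rw [integral_const_mul, Real.rpow_sub hε] at h
  simp at h
  field_simp at h
  rw [show 2 * ν - 2 = 2 * (ν - 1) by ring, ← h]

theorem pointwise_bound (ν C : ℝ) (hC : 0 ≤ C) (v η : E2 → ℝ) (x : E2) (ε : ℝ) (hε : 0 < ε)
    (hx0 : x ≠ 0) (hx : ‖x‖ < 2 * ε) (hvd : DifferentiableAt ℝ v x)
    (hv : |v x| ≤ C * ‖x‖ ^ ν) (hdv : ‖fderiv ℝ v x‖ ≤ C * ‖x‖ ^ (ν - 1))
    (hη : Differentiable ℝ η) (h01 : ∀ x : E2, 0 ≤ η x ∧ η x ≤ 1)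
    (h1 : ∀ x : E2, ‖x‖ < 1 → η x = 1)
    (hdη : ∀ x : E2, 1 ≤ ‖x‖ → ‖x‖ < 2 → ‖fderiv ℝ η x‖ ≤ 2) :
    ‖fderiv ℝ (fun y => η (ε⁻¹ • y) * v y) x‖ ^ 2 ≤ 25 * C ^ 2 * ‖x‖ ^ (2 * ν - 2) := by
  have hpos : 0 < ‖x‖ := norm_pos_iff.2 hx0
  have hny : ‖ε⁻¹ • x‖ = ε⁻¹ * ‖x‖ := by
    rw [norm_smul, Real.norm_of_nonneg (by positivity)]
  have hy2 : ε⁻¹ * ‖x‖ < 2 := by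
    rw [inv_mul_lt_iff₀ hε]; linarith
  have hkey : ‖fderiv ℝ η (ε⁻¹ • x)‖ * (ε⁻¹ * ‖x‖) ≤ 4 := by
    rcases lt_or_ge (ε⁻¹ * ‖x‖) 1 with hlt | hge
    · have : η =ᶠ[nhds (ε⁻¹ • x)] fun _ => (1 : ℝ) := by
        have ho : IsOpen {y : E2 | ‖y‖ < 1} := isOpen_lt continuous_norm continuous_const
        filter_upwards [ho.mem_nhds (show ε⁻¹ • x ∈ {y : E2 | ‖y‖ < 1} by
          simpa only [Set.mem_ofPred_eq, hny] using hlt)] with y hy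
        exact h1 y hy
      rw [this.fderiv_eq]
      simp
    · have := hdη (ε⁻¹ • x) (by rw [hny]; exact hge) (by rw [hny]; exact hy2)
      calc _ ≤ (2 : ℝ) * 2 := by gcongr
        _ = 4 := by norm_num
  have hd1 : HasFDerivAt (fun y : E2 => η (ε⁻¹ • y))
      (ε⁻¹ • fderiv ℝ η (ε⁻¹ • x)) x := by
    have ha := (hη (ε⁻¹ • x)).hasFDerivAt.comp x ((hasFDerivAt_id (𝕜 := ℝ) x).const_smul ε⁻¹)
    refine ha.congr_fderiv ?_
    ext z
    simp
  have hd := hd1.mul hvd.hasFDerivAt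
  have hb : ‖fderiv ℝ (fun y => η (ε⁻¹ • y) * v y) x‖ ≤ 5 * C * ‖x‖ ^ (ν - 1) := by
    have he : fderiv ℝ (fun y => η (ε⁻¹ • y) * v y) x = _ := hd.fderiv
    rw [he]
    have hη1 : |η (ε⁻¹ • x)| ≤ 1 := by
      rw [abs_of_nonneg (h01 _).1]; exact (h01 _).2
    have hpow : ‖x‖ ^ ν = ‖x‖ ^ (ν - 1) * ‖x‖ := by
      rw [← Real.rpow_add_one hpos.ne']; congr 1; ring
    calc _ ≤ ‖η (ε⁻¹ • x) • fderiv ℝ v x‖ + ‖v x • ε⁻¹ • fderiv ℝ η (ε⁻¹ • x)‖ :=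
          norm_add_le _ _
      _ = |η (ε⁻¹ • x)| * ‖fderiv ℝ v x‖ + |v x| * (ε⁻¹ * ‖fderiv ℝ η (ε⁻¹ • x)‖) := by
          rw [norm_smul, norm_smul, norm_smul, Real.norm_eq_abs, Real.norm_eq_abs,
            Real.norm_of_nonneg (show 0 ≤ ε⁻¹ by positivity)]
      _ ≤ 1 * (C * ‖x‖ ^ (ν - 1)) +
            C * (‖x‖ ^ (ν - 1) * ‖x‖) * (ε⁻¹ * ‖fderiv ℝ η (ε⁻¹ • x)‖) := by
          rw [← hpow]; gcongr
      _ = C * ‖x‖ ^ (ν - 1) +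
            C * ‖x‖ ^ (ν - 1) * (‖fderiv ℝ η (ε⁻¹ • x)‖ * (ε⁻¹ * ‖x‖)) := by ring
      _ ≤ C * ‖x‖ ^ (ν - 1) + C * ‖x‖ ^ (ν - 1) * 4 := by gcongr
      _ = _ := by ring
  calc _ ≤ (5 * C * ‖x‖ ^ (ν - 1)) ^ 2 := by gcongr
    _ = 25 * C ^ 2 * (‖x‖ ^ (ν - 1)) ^ 2 := by ring
    _ = _ := by
      rw [← Real.rpow_mul_natCast hpos.le]
      congr 2
      push_cast
      ring

theorem cutoff_energy_estimate (ν C : ℝ) (hν : 0 < ν) (hC : 0 ≤ C) :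
    ∃ C' : ℝ, 0 < C' ∧
      ∀ Γ : Set E2, IsClosed Γ → volume Γ = 0 →
        ∀ v : E2 → ℝ,
          (∀ x ∈ Metric.ball (0 : E2) 2 \ Γ, DifferentiableAt ℝ v x) →
          (∀ x ∈ Metric.ball (0 : E2) 2 \ Γ, |v x| ≤ C * ‖x‖ ^ ν) →
          (∀ x ∈ Metric.ball (0 : E2) 2 \ Γ, x ≠ 0 → ‖fderiv ℝ v x‖ ≤ C * ‖x‖ ^ (ν - 1)) →
          ∀ η : E2 → ℝ, Differentiable ℝ η →
            (∀ x : E2, 0 ≤ η x ∧ η x ≤ 1) →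
            (∀ x : E2, ‖x‖ < 1 → η x = 1) →
            (∀ x : E2, 2 ≤ ‖x‖ → η x = 0) →
            (∀ x : E2, 1 ≤ ‖x‖ → ‖x‖ < 2 → ‖fderiv ℝ η x‖ ≤ 2) →
            ∀ ε : ℝ, ε ∈ Set.Ioc (0 : ℝ) 1 →
              ∫⁻ x in Metric.ball (0 : E2) (2 * ε) \ Γ,
                  ENNReal.ofReal (‖fderiv ℝ (fun y => η (ε⁻¹ • y) * v y) x‖ ^ 2) ≤
                ENNReal.ofReal (C' * ε ^ (2 * ν)) := by
  set I : ℝ := ∫ x in Metric.ball (0 : E2) 2, ‖x‖ ^ (2 * ν - 2) with hI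
  have hI0 : 0 ≤ I := integral_nonneg fun x => by positivity
  refine ⟨25 * C ^ 2 * I + 1, by positivity, ?_⟩
  intro Γ hΓ _ v hvd hv hdv η hη h01 h1 _ hdη ε hε
  obtain ⟨hε0, hε1⟩ := hε
  have hae : ∀ᵐ x ∂(volume : Measure E2), x ≠ 0 := by
    simp [ae_iff]
  calc _ ≤ ∫⁻ x in Metric.ball (0 : E2) (2 * ε) \ Γ,
        ENNReal.ofReal (25 * C ^ 2 * ‖x‖ ^ (2 * ν - 2)) := by
        apply lintegral_mono_ae
        filter_upwards [ae_restrict_mem (Metric.isOpen_ball.measurableSet.diff hΓ.measurableSet),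
          ae_restrict_of_ae hae] with x hx hx0
        apply ENNReal.ofReal_le_ofReal
        have hxn : ‖x‖ < 2 * ε := by simpa using hx.1
        have hx2 : x ∈ Metric.ball (0 : E2) 2 \ Γ := by
          refine ⟨?_, hx.2⟩
          rw [mem_ball_zero_iff]
          linarith
        exact pointwise_bound ν C hC v η x ε hε0 hx0 hxn (hvd x hx2) (hv x hx2)
          (hdv x hx2 hx0) hη h01 h1 hdη
    _ ≤ ∫⁻ x in Metric.ball (0 : E2) (2 * ε),
        ENNReal.ofReal (25 * C ^ 2 * ‖x‖ ^ (2 * ν - 2)) := lintegral_mono_set Set.sdiff_subset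
    _ = ENNReal.ofReal (∫ x in Metric.ball (0 : E2) (2 * ε),
          25 * C ^ 2 * ‖x‖ ^ (2 * ν - 2)) := by
        rw [ofReal_integral_eq_lintegral_ofReal]
        · exact (radial_integrable ν hν _).const_mul _
        · exact Filter.Eventually.of_forall fun x => by simp only [Pi.zero_apply]; positivity
    _ ≤ _ := by
        apply ENNReal.ofReal_le_ofReal
        rw [integral_const_mul, radial_scaling ν ε hε0, ← hI]
        have : 0 ≤ ε ^ (2 * ν) := by positivity
        nlinarith
end
end
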